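/- arXiv:1007.4977 — 3 statements merged into one kernel-verified Lean document; each statement's English description precedes it below -/
import Mathlib

section
/- Let R be a countable ring and let D denote the class of all flat Mittag-Leffler right R-modules. Then the double orthogonal class ^⊥(D^⊥) consists precisely of all flat right R-modules: a module M satisfies Ext^1_R(M, C) = 0 for every module C ∈ D^⊥ if and only if M is flat. -/
/-! Tensor product of a right `R`-module with a left `R`-module over a
(possibly noncommutative) ring `R`, Mittag-Leffler modules, flat right modules. -/

universe u

open scoped TensorProduct DirectSum

section NCTensor

variable (R : Type u) [Ring R] (M : Type u) [AddCommGroup M] [Module Rᵐᵒᵖ M]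

/-- The subgroup of balancing relations in `M ⊗_ℤ Q`, where `M` is a right `R`-module
and `Q` is a left `R`-module. -/
noncomputable def balancedSub (Q : Type u) [AddCommGroup Q] [Module R Q] :
    AddSubgroup (TensorProduct ℤ M Q) :=
  AddSubgroup.closure
    {x | ∃ (m : M) (r : R) (q : Q),
      x = (MulOpposite.op r • m) ⊗ₜ[ℤ] q - m ⊗ₜ[ℤ] (r • q)}

/-- The tensor product `M ⊗_R Q` of a right `R`-module `M` and a left `R`-module `Q`. -/
def NCTensor (Q : Type u) [AddCommGroup Q] [Module R Q] : Type u :=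
  TensorProduct ℤ M Q ⧸ balancedSub R M Q

noncomputable instance (Q : Type u) [AddCommGroup Q] [Module R Q] : AddCommGroup (NCTensor R M Q) :=
  inferInstanceAs (AddCommGroup (TensorProduct ℤ M Q ⧸ balancedSub R M Q))

/-- The canonical projection onto the tensor product `M ⊗_R Q`. -/
noncomputable def NCTensor.mk (Q : Type u) [AddCommGroup Q] [Module R Q] :
    TensorProduct ℤ M Q →+ NCTensor R M Q :=
  QuotientAddGroup.mk' (balancedSub R M Q)

variable {R M} in
/-- The map `M ⊗_R Q →+ M ⊗_R Q'` induced by a map of left `R`-modules `f : Q → Q'`. -/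
noncomputable def NCTensor.map {Q Q' : Type u} [AddCommGroup Q] [Module R Q]
    [AddCommGroup Q'] [Module R Q'] (f : Q →ₗ[R] Q') :
    NCTensor R M Q →+ NCTensor R M Q' :=
  QuotientAddGroup.lift (balancedSub R M Q)
    ((NCTensor.mk R M Q').comp
      (LinearMap.lTensor M f.toAddMonoidHom.toIntLinearMap).toAddMonoidHom)
    (by
      set φ := (NCTensor.mk R M Q').comp
        (LinearMap.lTensor M f.toAddMonoidHom.toIntLinearMap).toAddMonoidHom with hφ
      intro x hx
      have hle : balancedSub R M Q ≤ φ.ker := by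
        rw [balancedSub]
        rw [AddSubgroup.closure_le]
        rintro _ ⟨m, r, q, rfl⟩
        have h1 : φ ((MulOpposite.op r • m) ⊗ₜ[ℤ] q - m ⊗ₜ[ℤ] (r • q)) =
            NCTensor.mk R M Q'
              ((MulOpposite.op r • m) ⊗ₜ[ℤ] (f q) - m ⊗ₜ[ℤ] (r • f q)) := by
          simp [hφ, LinearMap.lTensor_tmul, map_sub]
        simp only [SetLike.mem_coe, AddMonoidHom.mem_ker, h1]
        exact (QuotientAddGroup.eq_zero_iff _).2
          (AddSubgroup.subset_closure ⟨m, r, f q, rfl⟩)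
      exact hle hx)

variable {ι : Type u} (Q : ι → Type u) [∀ i, AddCommGroup (Q i)] [∀ i, Module R (Q i)]

/-- Auxiliary map for the Mittag-Leffler comparison map. -/
noncomputable def piCompareAux :
    TensorProduct ℤ M (∀ i, Q i) →+ ∀ i, NCTensor R M (Q i) where
  toFun x i := NCTensor.mk R M (Q i)
    (LinearMap.lTensor M (LinearMap.proj (R := ℤ) (φ := Q) i) x)
  map_zero' := by funext i; simp
  map_add' x y := by funext i; simp [map_add]

/-- The canonical comparison map `M ⊗_R (∏ i, Q i) →+ ∏ i, (M ⊗_R Q i)`. -/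
noncomputable def mlCompare : NCTensor R M (∀ i, Q i) →+ ∀ i, NCTensor R M (Q i) :=
  QuotientAddGroup.lift (balancedSub R M (∀ i, Q i)) (piCompareAux R M Q)
    (by
      intro x hx
      have hle : balancedSub R M (∀ i, Q i) ≤ (piCompareAux R M Q).ker := by
        rw [balancedSub, AddSubgroup.closure_le]
        rintro _ ⟨m, r, q, rfl⟩
        simp only [SetLike.mem_coe, AddMonoidHom.mem_ker]
        funext i
        have h1 : piCompareAux R M Q
            ((MulOpposite.op r • m) ⊗ₜ[ℤ] q - m ⊗ₜ[ℤ] (r • q)) i =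
            NCTensor.mk R M (Q i)
              ((MulOpposite.op r • m) ⊗ₜ[ℤ] (q i) - m ⊗ₜ[ℤ] (r • q i)) := by
          simp [piCompareAux, map_sub, LinearMap.lTensor_tmul]
        rw [Pi.zero_apply, h1]
        exact (QuotientAddGroup.eq_zero_iff _).2
          (AddSubgroup.subset_closure ⟨m, r, q i, rfl⟩)
      exact hle hx)

/-- A right `R`-module `M` is Mittag-Leffler if for every family `(Q i)` of left
`R`-modules the canonical map `M ⊗_R ∏ Q i → ∏ (M ⊗_R Q i)` is injective. -/
def IsMittagLeffler : Prop :=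
  ∀ (ι : Type u) (Q : ι → Type u) [∀ i, AddCommGroup (Q i)] [∀ i, Module R (Q i)],
    Function.Injective (mlCompare R M Q)

/-- A right `R`-module `M` is flat if tensoring with `M` preserves injectivity of maps
of left `R`-modules. -/
def IsRightFlat : Prop :=
  ∀ (Q Q' : Type u) [AddCommGroup Q] [AddCommGroup Q'] [Module R Q] [Module R Q']
    (f : Q →ₗ[R] Q'), Function.Injective f →
      Function.Injective (NCTensor.map (M := M) f)

end NCTensor
section ExtGroup

open CategoryTheory

/-- The first Ext group `Ext¹_R(X, Y)` of two right `R`-modules, as a `ℤ`-module. -/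
noncomputable def ext1 (R : Type u) [Ring R] (X Y : ModuleCat.{u} Rᵐᵒᵖ) : ModuleCat ℤ :=
  ((_root_.Ext ℤ (ModuleCat.{u} Rᵐᵒᵖ) 1).obj (Opposite.op X)).obj Y

end ExtGroup

section ExtensionProperty

variable {S : Type u} [Ring S]

/-- Every linear map into `C` from the kernel of a surjection onto `X` extends to the source of
that surjection; this is the vanishing of `Ext¹(X, C)`. -/
def ExtVanish (S : Type u) [Ring S] (X C : Type u) [AddCommGroup X] [Module S X]
    [AddCommGroup C] [Module S C] : Prop :=
  ∀ (E : Type u) [AddCommGroup E] [Module S E] (p : E →ₗ[S] X), Function.Surjective p →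
    ∀ f : LinearMap.ker p →ₗ[S] C, ∃ g : E →ₗ[S] C, ∀ k : LinearMap.ker p, g k = f k

variable {X C : Type u} [AddCommGroup X] [Module S X] [AddCommGroup C] [Module S C]

theorem exists_comp_eq_of_surjective {Z E : Type u} [AddCommGroup Z] [Module S Z]
    [AddCommGroup E] [Module S E] (s : Z →ₗ[S] E) (hs : Function.Surjective s) (t : Z →ₗ[S] C)
    (hle : ∀ z, s z = 0 → t z = 0) : ∃ g : E →ₗ[S] C, ∀ z, g (s z) = t z := by
  refine ⟨(LinearMap.ker s).liftQ t hle ∘ₗ (s.quotKerEquivOfSurjective hs).symm.toLinearMap,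
    fun z => ?_⟩
  have : (s.quotKerEquivOfSurjective hs).symm (s z) = Submodule.Quotient.mk z := by
    rw [LinearEquiv.symm_apply_eq]; rfl
  rw [LinearMap.comp_apply, LinearEquiv.coe_coe, this]
  exact Submodule.liftQ_apply _ _ z

/-- Two maps on a jointly surjective pair of modules that are compatible on the relations
glue. -/
theorem exists_glue {P K E : Type u} [AddCommGroup P] [Module S P]
    [AddCommGroup K] [Module S K] [AddCommGroup E] [Module S E]
    (h : P →ₗ[S] E) (i : K →ₗ[S] E) (hsurj : ∀ e, ∃ x k, h x + i k = e)
    (a : P →ₗ[S] C) (b : K →ₗ[S] C) (hab : ∀ x k, h x + i k = 0 → a x + b k = 0) :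
    ∃ g : E →ₗ[S] C, (∀ x, g (h x) = a x) ∧ ∀ k, g (i k) = b k := by
  obtain ⟨g, hg⟩ := exists_comp_eq_of_surjective (h.coprod i) (fun e => by
    obtain ⟨x, k, rfl⟩ := hsurj e
    exact ⟨(x, k), rfl⟩) (a.coprod b) (fun z hz => hab z.1 z.2 hz)
  exact ⟨g, fun x => by simpa using hg (x, 0), fun k => by simpa using hg (0, k)⟩

/-- It suffices to check `ExtVanish` on one projective presentation. -/
theorem ExtVanish.of_presentation {P : Type u} [AddCommGroup P] [Module S P]
    [Module.Projective S P] (q : P →ₗ[S] X) (hq : Function.Surjective q)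
    (hext : ∀ f : LinearMap.ker q →ₗ[S] C, ∃ g : P →ₗ[S] C, ∀ k : LinearMap.ker q, g k = f k) :
    ExtVanish S X C := by
  intro E _ _ p hp f
  obtain ⟨h, hh⟩ := Module.projective_lifting_property p q hp
  have hmem : ∀ x : LinearMap.ker q, h x ∈ LinearMap.ker p := fun x => by
    have := congr($hh x.1)
    simpa using this
  obtain ⟨a, ha⟩ := hext (f ∘ₗ (h ∘ₗ (LinearMap.ker q).subtype).codRestrict _ hmem)
  obtain ⟨g, -, hg⟩ := exists_glue (C := C) h (LinearMap.ker p).subtype (fun e => by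
      obtain ⟨x, hx⟩ := hq (p e)
      refine ⟨x, ⟨e - h x, ?_⟩, by simp⟩
      have := congr($hh x)
      simp at this
      simp [this, hx]) a f (fun x k hxk => by
      have hx : x ∈ LinearMap.ker q := by
        have h1 := congr(p $hxk)
        have h2 := congr($hh x)
        have h3 : p k = 0 := k.2
        simp [h3] at h1 h2
        simp [← h2, h1]
      have h1 := ha ⟨x, hx⟩
      have h2 : (⟨h x, hmem ⟨x, hx⟩⟩ : LinearMap.ker p) + k = 0 := Subtype.ext hxk
      simp only [LinearMap.comp_apply] at h1
      have h3 := congr(f $h2)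
      rw [map_add, map_zero] at h3
      rw [h1]
      exact h3)
  exact ⟨g, fun k => hg k⟩

open CategoryTheory in
theorem subsingleton_ext1_iff (R : Type u) [Ring R] (X Y : ModuleCat.{u} Rᵐᵒᵖ) :
    Subsingleton (ext1 R X Y) ↔ ExtVanish Rᵐᵒᵖ X Y := by
  let P := projectiveResolution X
  let d₂ : P.complex.X 2 →ₗ[Rᵐᵒᵖ] P.complex.X 1 := (P.complex.d 2 1).hom
  let d₁ : P.complex.X 1 →ₗ[Rᵐᵒᵖ] P.complex.X 0 := (P.complex.d 1 0).hom
  let q : P.complex.X 0 →ₗ[Rᵐᵒᵖ] X := (P.π.f 0).hom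
  have hq : Function.Surjective q := (ModuleCat.epi_iff_surjective (P.π.f 0)).1 inferInstance
  have hex₀ : ∀ x, q x = 0 → ∃ y, d₁ y = x :=
    (ShortComplex.moduleCat_exact_iff _).1 P.exact₀
  have hqd : ∀ y, q (d₁ y) = 0 := fun y => congr($(P.complex_d_comp_π_f_zero).hom y)
  have hex₁ : ∀ x, d₁ x = 0 → ∃ y, d₂ y = x :=
    (ShortComplex.moduleCat_exact_iff _).1 (P.exact_succ 0)
  have hdd : ∀ y, d₁ (d₂ y) = 0 := fun y => congr($(P.complex.d_comp_d 2 1 0).hom y)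
  have h0 : Subsingleton (ext1 R X Y) ↔ ∀ f : P.complex.X 1 →ₗ[Rᵐᵒᵖ] Y, f ∘ₗ d₂ = 0 →
      ∃ g : P.complex.X 0 →ₗ[Rᵐᵒᵖ] Y, g ∘ₗ d₁ = f := by
    rw [ext1, ← ModuleCat.isZero_iff_subsingleton, (P.isoExt (R := ℤ) 1 Y).isZero_iff,
      ← HomologicalComplex.exactAt_iff_isZero_homology,
      HomologicalComplex.exactAt_iff' _ 0 1 2 (by simp) (by simp),
      ShortComplex.moduleCat_exact_iff]
    constructor
    · intro h f hf
      obtain ⟨g, hg⟩ := h (ModuleCat.ofHom f) (ModuleCat.hom_ext hf)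
      exact ⟨g.hom, congr(ModuleCat.Hom.hom $hg)⟩
    · intro h f hf
      obtain ⟨g, hg⟩ := h (ModuleCat.Hom.hom f) congr(ModuleCat.Hom.hom $hf)
      exact ⟨ModuleCat.ofHom g, ModuleCat.hom_ext hg⟩
  have : Module.Projective Rᵐᵒᵖ (P.complex.X 0) :=
    (IsProjective.iff_projective (P.complex.X 0)).2 (P.projective 0)
  rw [h0]
  constructor
  · intro h
    refine ExtVanish.of_presentation q hq fun f => ?_
    obtain ⟨g, hg⟩ := h (f ∘ₗ d₁.codRestrict _ hqd) (by
      ext y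
      have : d₁.codRestrict (LinearMap.ker q) hqd (d₂ y) = 0 := Subtype.ext (hdd y)
      simp [this])
    refine ⟨g, fun k => ?_⟩
    obtain ⟨y, hy⟩ := hex₀ k k.2
    have h1 := congr($hg y)
    have h2 : d₁.codRestrict (LinearMap.ker q) hqd y = k := Subtype.ext hy
    simpa [h2, hy] using h1
  · intro h f hf
    let d := d₁.codRestrict (LinearMap.ker q) hqd
    obtain ⟨f', hf'⟩ := exists_comp_eq_of_surjective d (fun k => by
        obtain ⟨y, hy⟩ := hex₀ k k.2
        exact ⟨y, Subtype.ext hy⟩) f (fun z hz => by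
      obtain ⟨y, rfl⟩ := hex₁ z congr(Subtype.val $hz)
      exact congr($hf y))
    obtain ⟨g, hg⟩ := h _ q hq f'
    exact ⟨g, LinearMap.ext fun y => (hg (d y)).trans (hf' y)⟩

end ExtensionProperty

section NCTensorAPI

variable {R : Type u} [Ring R] {M : Type u} [AddCommGroup M] [Module Rᵐᵒᵖ M]
variable {Q Q' : Type u} [AddCommGroup Q] [Module R Q] [AddCommGroup Q'] [Module R Q']

namespace NCTensor

/-- The pure tensor `m ⊗ q`. -/
noncomputable def tmul (R : Type u) [Ring R] {M Q : Type u} [AddCommGroup M] [Module Rᵐᵒᵖ M]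
    [AddCommGroup Q] [Module R Q] (m : M) (q : Q) : NCTensor R M Q :=
  NCTensor.mk R M Q (m ⊗ₜ[ℤ] q)

theorem tmul_add (m : M) (q q' : Q) : tmul R m (q + q') = tmul R m q + tmul R m q' := by
  simp [tmul, TensorProduct.tmul_add]

theorem add_tmul (m m' : M) (q : Q) : tmul R (m + m') q = tmul R m q + tmul R m' q := by
  simp [tmul, TensorProduct.add_tmul]

theorem tmul_zero (m : M) : tmul R m (0 : Q) = 0 := by simp [tmul]

theorem zero_tmul (q : Q) : tmul R (0 : M) q = 0 := by simp [tmul]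

theorem smul_tmul (m : M) (r : R) (q : Q) :
    tmul R (MulOpposite.op r • m) q = tmul R m (r • q) := by
  rw [← sub_eq_zero, tmul, tmul, ← map_sub]
  exact (QuotientAddGroup.eq_zero_iff _).2 (AddSubgroup.subset_closure ⟨m, r, q, rfl⟩)

theorem sum_tmul {ι : Type*} (s : Finset ι) (m : ι → M) (q : Q) :
    tmul R (∑ i ∈ s, m i) q = ∑ i ∈ s, tmul R (m i) q := by
  classical
  induction s using Finset.induction_on with
  | empty => simp [zero_tmul]
  | insert a s ha ih => rw [Finset.sum_insert ha, Finset.sum_insert ha, add_tmul, ih]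

theorem induction_on {p : NCTensor R M Q → Prop} (z : NCTensor R M Q) (h0 : p 0)
    (ht : ∀ m q, p (tmul R m q)) (ha : ∀ x y, p x → p y → p (x + y)) : p z := by
  obtain ⟨z, rfl⟩ := QuotientAddGroup.mk'_surjective _ z
  change p (NCTensor.mk R M Q z)
  induction z using TensorProduct.induction_on with
  | zero => simpa using h0
  | tmul m q => exact ht m q
  | add x y hx hy => rw [map_add]; exact ha _ _ hx hy

@[simp]
theorem map_tmul (f : Q →ₗ[R] Q') (m : M) (q : Q) :
    NCTensor.map f (tmul R m q) = tmul R m (f q) := rfl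

/-- The map out of `M ⊗_R Q` induced by a balanced biadditive map. -/
noncomputable def lift {A : Type*} [AddCommGroup A] (b : M →+ Q →+ A)
    (hb : ∀ m (r : R) q, b (MulOpposite.op r • m) q = b m (r • q)) : NCTensor R M Q →+ A :=
  QuotientAddGroup.lift (balancedSub R M Q)
    (TensorProduct.liftAddHom b fun n m q => by simp) (by
      intro x hx
      have hle : balancedSub R M Q ≤ (TensorProduct.liftAddHom (R := ℤ) b
          fun n m q => by simp).ker := by
        rw [balancedSub, AddSubgroup.closure_le]
        rintro _ ⟨m, r, q, rfl⟩
        simp [hb]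
      exact hle hx)

theorem addHom_ext {A : Type*} [AddCommGroup A] {f g : NCTensor R M Q →+ A}
    (h : ∀ m q, f (tmul R m q) = g (tmul R m q)) : f = g := by
  ext z
  induction z using induction_on with
  | h0 => simp
  | ht m q => exact h m q
  | ha x y hx hy => simp [hx, hy]

/-- Contraction of the first factor with a functional. -/
noncomputable def contract (Q : Type u) [AddCommGroup Q] [Module R Q] (φ : M →ₗ[Rᵐᵒᵖ] Rᵐᵒᵖ) :
    NCTensor R M Q →+ Q :=
  lift (AddMonoidHom.mk' (fun m => AddMonoidHom.mk' (fun q => (φ m).unop • q)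
      (fun a b => smul_add _ a b)) (fun a b => by ext; simp [add_smul]))
    (fun m r q => by simp [mul_smul])

@[simp]
theorem contract_tmul (φ : M →ₗ[Rᵐᵒᵖ] Rᵐᵒᵖ) (m : M) (q : Q) :
    contract Q φ (tmul R m q) = (φ m).unop • q := rfl

theorem contract_map (φ : M →ₗ[Rᵐᵒᵖ] Rᵐᵒᵖ) (f : Q →ₗ[R] Q') (z : NCTensor R M Q) :
    contract Q' φ (NCTensor.map f z) = f (contract Q φ z) := by
  induction z using induction_on with
  | h0 => simp
  | ht m q => simp
  | ha x y hx hy => simp [hx, hy]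

theorem mlCompare_apply {ι : Type u} {Q : ι → Type u} [∀ i, AddCommGroup (Q i)]
    [∀ i, Module R (Q i)] (z : NCTensor R M (∀ i, Q i)) (j : ι) :
    mlCompare R M Q z j = NCTensor.map (LinearMap.proj (R := R) (φ := Q) j) z := by
  induction z using induction_on with
  | h0 => simp
  | ht m q => rfl
  | ha x y hx hy => simp [hx, hy]

end NCTensor

end NCTensorAPI

section LocallyProjective

/-- Every finite subset of `M` is fixed by an endomorphism that factors through a
finitely generated free module. -/
def LocallyProjective (S : Type u) [Ring S] (M : Type u) [AddCommGroup M] [Module S M] : Prop :=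
  ∀ X : Finset M, ∃ (ι : Type u) (I : Finset ι) (x : ι → M) (φ : ι → M →ₗ[S] S),
    ∀ m ∈ X, ∑ i ∈ I, φ i m • x i = m

theorem LocallyProjective.of_factor {S : Type u} [Ring S] {M : Type u} [AddCommGroup M]
    [Module S M] (h : ∀ X : Finset M, ∃ (ι : Type u) (a : M →ₗ[S] (ι →₀ S))
      (b : (ι →₀ S) →ₗ[S] M), ∀ m ∈ X, b (a m) = m) : LocallyProjective S M := by
  classical
  intro X
  obtain ⟨ι, a, b, hab⟩ := h X
  refine ⟨ι, X.biUnion fun m => (a m).support, fun i => b (Finsupp.single i 1),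
    fun i => Finsupp.lapply i ∘ₗ a, fun m hm => ?_⟩
  have h1 : a m = ∑ i ∈ X.biUnion fun m => (a m).support, (a m i) • Finsupp.single i (1 : S) := by
    conv_lhs => rw [← Finsupp.sum_single (a m), Finsupp.sum]
    refine (Finset.sum_subset (Finset.subset_biUnion_of_mem (fun m => (a m).support) hm)
      fun i _ hi => ?_).trans (Finset.sum_congr rfl fun i _ => by simp)
    simp [Finsupp.notMem_support_iff.1 hi]
  conv_rhs => rw [← hab m hm, h1, map_sum]
  exact Finset.sum_congr rfl fun i _ => by rw [map_smul]; rfl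

variable {R : Type u} [Ring R] {M : Type u} [AddCommGroup M] [Module Rᵐᵒᵖ M]

theorem LocallyProjective.exists_eq_sum_contract (hM : LocallyProjective Rᵐᵒᵖ M)
    {Q : Type u} [AddCommGroup Q] [Module R Q] (z : NCTensor R M Q) :
    ∃ (ι : Type u) (I : Finset ι) (x : ι → M) (φ : ι → M →ₗ[Rᵐᵒᵖ] Rᵐᵒᵖ),
      ∑ i ∈ I, NCTensor.tmul R (x i) (NCTensor.contract Q (φ i) z) = z := by
  classical
  have key : ∃ X : Finset M, ∀ (ι : Type u) (I : Finset ι) (x : ι → M)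
      (φ : ι → M →ₗ[Rᵐᵒᵖ] Rᵐᵒᵖ), (∀ m ∈ X, ∑ i ∈ I, φ i m • x i = m) →
      ∑ i ∈ I, NCTensor.tmul R (x i) (NCTensor.contract Q (φ i) z) = z := by
    induction z using NCTensor.induction_on with
    | h0 => exact ⟨∅, fun ι I x φ _ => by simp [NCTensor.tmul_zero]⟩
    | ht m q =>
      refine ⟨{m}, fun ι I x φ h => ?_⟩
      conv_rhs => rw [← h m (by simp), NCTensor.sum_tmul]
      refine Finset.sum_congr rfl fun i _ => ?_
      rw [NCTensor.contract_tmul, ← NCTensor.smul_tmul, MulOpposite.op_unop]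
    | ha a b ha hb =>
      obtain ⟨X, hX⟩ := ha
      obtain ⟨Y, hY⟩ := hb
      refine ⟨X ∪ Y, fun ι I x φ h => ?_⟩
      simp only [map_add, NCTensor.tmul_add, Finset.sum_add_distrib]
      rw [hX ι I x φ fun m hm => h m (Finset.mem_union_left _ hm),
        hY ι I x φ fun m hm => h m (Finset.mem_union_right _ hm)]
  obtain ⟨X, hX⟩ := key
  obtain ⟨ι, I, x, φ, h⟩ := hM X
  exact ⟨ι, I, x, φ, hX ι I x φ h⟩

theorem LocallyProjective.isRightFlat (hM : LocallyProjective Rᵐᵒᵖ M) : IsRightFlat R M := by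
  intro Q Q' _ _ _ _ f hf
  rw [injective_iff_map_eq_zero]
  intro z hz
  obtain ⟨ι, I, x, φ, h⟩ := hM.exists_eq_sum_contract z
  rw [← h]
  refine Finset.sum_eq_zero fun i _ => ?_
  have : f (NCTensor.contract Q (φ i) z) = f 0 := by
    rw [← NCTensor.contract_map, hz, map_zero, map_zero]
  rw [hf this, NCTensor.tmul_zero]

theorem LocallyProjective.isMittagLeffler (hM : LocallyProjective Rᵐᵒᵖ M) :
    IsMittagLeffler R M := by
  intro ι Q _ _
  rw [injective_iff_map_eq_zero]
  intro z hz
  obtain ⟨ι', I, x, φ, h⟩ := hM.exists_eq_sum_contract z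
  rw [← h]
  refine Finset.sum_eq_zero fun i _ => ?_
  have : NCTensor.contract (∀ j, Q j) (φ i) z = 0 := by
    funext j
    have hj : NCTensor.contract (Q j) (φ i) (mlCompare R M Q z j) =
        NCTensor.contract (∀ j, Q j) (φ i) z j := by
      rw [NCTensor.mlCompare_apply, NCTensor.contract_map, LinearMap.proj_apply]
    rw [← hj, hz, Pi.zero_apply, map_zero, Pi.zero_apply]
  rw [this, NCTensor.tmul_zero]

end LocallyProjective

section RightDual

variable {R : Type u} [Ring R]

/-- The right `R`-module of characters of a left `R`-module. -/
def RightDual (R : Type u) [Ring R] (Q : Type u) [AddCommGroup Q] [Module R Q] : Type u :=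
  Q →+ AddCircle (1 : ℚ)

namespace RightDual

variable {Q Q' : Type u} [AddCommGroup Q] [Module R Q] [AddCommGroup Q'] [Module R Q']

instance : AddCommGroup (RightDual R Q) := inferInstanceAs (AddCommGroup (Q →+ AddCircle (1 : ℚ)))

instance : FunLike (RightDual R Q) Q (AddCircle (1 : ℚ)) :=
  inferInstanceAs (FunLike (Q →+ AddCircle (1 : ℚ)) Q (AddCircle (1 : ℚ)))

instance : AddMonoidHomClass (RightDual R Q) Q (AddCircle (1 : ℚ)) :=
  inferInstanceAs (AddMonoidHomClass (Q →+ AddCircle (1 : ℚ)) Q (AddCircle (1 : ℚ)))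

@[ext]
theorem ext {f g : RightDual R Q} (h : ∀ q, f q = g q) : f = g := DFunLike.ext _ _ h

@[simp]
theorem add_apply (f g : RightDual R Q) (q : Q) : (f + g) q = f q + g q := rfl

noncomputable instance : Module Rᵐᵒᵖ (RightDual R Q) where
  smul r f := AddMonoidHom.comp (f : Q →+ AddCircle (1 : ℚ)) (DistribSMul.toAddMonoidHom Q r.unop)
  one_smul f := ext fun q => congrArg f (one_smul R q)
  mul_smul r s f := ext fun q => congrArg f (mul_smul s.unop r.unop q)
  smul_zero _ := rfl
  smul_add _ _ _ := rfl
  add_smul r s f := ext fun q => (congrArg f (add_smul r.unop s.unop q)).trans (map_add f _ _)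
  zero_smul f := ext fun q => (congrArg f (zero_smul R q)).trans (map_zero f)

@[simp]
theorem smul_apply (r : Rᵐᵒᵖ) (f : RightDual R Q) (q : Q) : (r • f) q = f (r.unop • q) := rfl

/-- Precomposition with a linear map. -/
noncomputable def map (f : Q →ₗ[R] Q') : RightDual R Q' →ₗ[Rᵐᵒᵖ] RightDual R Q where
  toFun φ := AddMonoidHom.comp (φ : Q' →+ AddCircle (1 : ℚ)) f.toAddMonoidHom
  map_add' _ _ := rfl
  map_smul' r φ := ext fun q => congrArg φ (map_smul f r.unop q).symm

@[simp]
theorem map_apply (f : Q →ₗ[R] Q') (φ : RightDual R Q') (q : Q) : map f φ q = φ (f q) := rfl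

end RightDual

/-- Characters of abelian groups extend along injections. -/
theorem exists_character_extension {A B : Type u} [AddCommGroup A] [AddCommGroup B] (f : A →+ B)
    (hf : Function.Injective f) (χ : A →+ AddCircle (1 : ℚ)) :
    ∃ χ' : B →+ AddCircle (1 : ℚ), ∀ a, χ' (f a) = χ a := by
  obtain ⟨χ', h⟩ := CharacterModule.dual_surjective_of_injective f.toIntLinearMap hf χ
  exact ⟨χ', fun a => DFunLike.congr_fun h a⟩

variable {M : Type u} [AddCommGroup M] [Module Rᵐᵒᵖ M]
variable {Q Q' : Type u} [AddCommGroup Q] [Module R Q] [AddCommGroup Q'] [Module R Q']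

/-- The linear map `M → Q⋆` attached to a character of `M ⊗_R Q`. -/
noncomputable def NCTensor.curryCharacter (χ : NCTensor R M Q →+ AddCircle (1 : ℚ)) :
    M →ₗ[Rᵐᵒᵖ] RightDual R Q where
  toFun m := AddMonoidHom.mk' (fun q => χ (NCTensor.tmul R m q)) fun a b => by
    rw [NCTensor.tmul_add, map_add]
  map_add' m m' := RightDual.ext fun q =>
    (congrArg χ (NCTensor.add_tmul m m' q)).trans (map_add χ _ _)
  map_smul' r m := RightDual.ext fun q => congrArg χ (NCTensor.smul_tmul m r.unop q)

@[simp]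
theorem NCTensor.curryCharacter_apply (χ : NCTensor R M Q →+ AddCircle (1 : ℚ)) (m : M) (q : Q) :
    NCTensor.curryCharacter χ m q = χ (NCTensor.tmul R m q) := rfl

/-- The character of `M ⊗_R Q` attached to a linear map `M → Q⋆`. -/
noncomputable def NCTensor.uncurryCharacter (h : M →ₗ[Rᵐᵒᵖ] RightDual R Q) :
    NCTensor R M Q →+ AddCircle (1 : ℚ) :=
  NCTensor.lift (AddMonoidHom.mk' (fun m => (h m : Q →+ AddCircle (1 : ℚ)))
    fun a b => map_add h a b) fun m r q => DFunLike.congr_fun (map_smul h (MulOpposite.op r) m) q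

@[simp]
theorem NCTensor.uncurryCharacter_tmul (h : M →ₗ[Rᵐᵒᵖ] RightDual R Q) (m : M) (q : Q) :
    NCTensor.uncurryCharacter h (NCTensor.tmul R m q) = h m q := rfl

theorem IsRightFlat.exists_lift (hM : IsRightFlat R M) (f : Q →ₗ[R] Q')
    (hf : Function.Injective f) (h : M →ₗ[Rᵐᵒᵖ] RightDual R Q) :
    ∃ h' : M →ₗ[Rᵐᵒᵖ] RightDual R Q', RightDual.map f ∘ₗ h' = h := by
  obtain ⟨χ, hχ⟩ := exists_character_extension _ (hM Q Q' f hf) (NCTensor.uncurryCharacter h)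
  refine ⟨NCTensor.curryCharacter χ, LinearMap.ext fun m => RightDual.ext fun q => ?_⟩
  simpa using hχ (NCTensor.tmul R m q)

theorem isRightFlat_of_exists_lift
    (H : ∀ (Q Q' : Type u) [AddCommGroup Q] [AddCommGroup Q'] [Module R Q] [Module R Q']
      (f : Q →ₗ[R] Q'), Function.Injective f → ∀ h : M →ₗ[Rᵐᵒᵖ] RightDual R Q,
      ∃ h' : M →ₗ[Rᵐᵒᵖ] RightDual R Q', RightDual.map f ∘ₗ h' = h) : IsRightFlat R M := by
  intro Q Q' _ _ _ _ f hf
  rw [injective_iff_map_eq_zero]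
  intro z hz
  refine CharacterModule.eq_zero_of_character_apply fun χ => ?_
  obtain ⟨h', hh'⟩ := H Q Q' f hf (NCTensor.curryCharacter χ)
  have : (NCTensor.uncurryCharacter h').comp (NCTensor.map f) = χ :=
    NCTensor.addHom_ext fun m q => by
      exact DFunLike.congr_fun congr($hh' m) q
  calc χ z = (NCTensor.uncurryCharacter h').comp (NCTensor.map f) z :=
        (DFunLike.congr_fun this z).symm
    _ = 0 := by rw [AddMonoidHom.comp_apply, hz, map_zero]

end RightDual

section FlatExt

theorem exists_comp_eq_of_injective {S : Type u} [Ring S] {A B E : Type u} [AddCommGroup A]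
    [Module S A] [AddCommGroup B] [Module S B] [AddCommGroup E] [Module S E]
    (j : A →ₗ[S] B) (hj : Function.Injective j) (H : E →ₗ[S] B) (hH : ∀ e, ∃ a, j a = H e) :
    ∃ g : E →ₗ[S] A, ∀ e, j (g e) = H e := by
  choose g hg using hH
  refine ⟨{ toFun := g, map_add' := fun x y => hj ?_, map_smul' := fun r x => hj ?_ }, hg⟩
  · simp [hg]
  · simp [hg]

variable {R : Type u} [Ring R] {M : Type u} [AddCommGroup M] [Module Rᵐᵒᵖ M]
variable {A B Q : Type u} [AddCommGroup A] [Module R A] [AddCommGroup B] [Module R B]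
  [AddCommGroup Q] [Module R Q]

theorem RightDual.map_injective (γ : B →ₗ[R] Q) (hγ : Function.Surjective γ) :
    Function.Injective (RightDual.map γ) := fun φ ψ h => RightDual.ext fun q => by
  obtain ⟨b, rfl⟩ := hγ q
  exact DFunLike.congr_fun h b

theorem RightDual.exists_lift_of_exact (i : A →ₗ[R] B) (γ : B →ₗ[R] Q)
    (hγ : Function.Surjective γ) (hex : ∀ b, γ b = 0 → ∃ a, i a = b)
    {E : Type u} [AddCommGroup E] [Module Rᵐᵒᵖ E] (H : E →ₗ[Rᵐᵒᵖ] RightDual R B)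
    (hH : ∀ e, RightDual.map i (H e) = 0) :
    ∃ g : E →ₗ[Rᵐᵒᵖ] RightDual R Q, ∀ e, RightDual.map γ (g e) = H e := by
  refine exists_comp_eq_of_injective _ (RightDual.map_injective γ hγ) H fun e => ?_
  have hker : γ.toAddMonoidHom.ker ≤ AddMonoidHom.ker (H e : B →+ AddCircle (1 : ℚ)) := by
    intro b hb
    obtain ⟨a, rfl⟩ := hex b hb
    exact DFunLike.congr_fun (hH e) a
  refine ⟨(AddMonoidHom.liftOfSurjective γ.toAddMonoidHom hγ
    ⟨(H e : B →+ AddCircle (1 : ℚ)), hker⟩ : Q →+ AddCircle (1 : ℚ)), RightDual.ext fun b => ?_⟩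
  exact AddMonoidHom.liftOfRightInverse_comp_apply γ.toAddMonoidHom _
    (Function.rightInverse_surjInv hγ) ⟨(H e : B →+ AddCircle (1 : ℚ)), hker⟩ b

/-- The dual of a free module is injective. -/
theorem RightDual.exists_extension_of_free (X : Type u) {K E : Type u} [AddCommGroup K]
    [Module Rᵐᵒᵖ K] [AddCommGroup E] [Module Rᵐᵒᵖ E] (i : K →ₗ[Rᵐᵒᵖ] E)
    (hi : Function.Injective i) (t : K →ₗ[Rᵐᵒᵖ] RightDual R (X →₀ R)) :
    ∃ T : E →ₗ[Rᵐᵒᵖ] RightDual R (X →₀ R), ∀ k, T (i k) = t k := by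
  have h1 : ∀ x : X, ∃ χ : E →+ AddCircle (1 : ℚ), ∀ k, χ (i k) = t k (Finsupp.single x 1) :=
    fun x => exists_character_extension i.toAddMonoidHom hi
      (AddMonoidHom.mk' (fun k => t k (Finsupp.single x 1)) fun a b => by simp)
  choose χ hχ using h1
  let c : E → X → R →+ AddCircle (1 : ℚ) := fun e x =>
    AddMonoidHom.mk' (fun r => χ x (MulOpposite.op r • e)) fun a b => by simp [add_smul]
  have hc : ∀ e x r, Finsupp.liftAddHom (c e) (Finsupp.single x r) = χ x (MulOpposite.op r • e) :=
    fun e x r => by simp [c]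
  have hext : ∀ φ ψ : RightDual R (X →₀ R), (∀ x r, φ (Finsupp.single x r) =
      ψ (Finsupp.single x r)) → φ = ψ := fun φ ψ h =>
    Finsupp.addHom_ext (f := (φ : (X →₀ R) →+ AddCircle (1 : ℚ))) h
  refine ⟨{ toFun := fun e => (Finsupp.liftAddHom (c e) : (X →₀ R) →+ AddCircle (1 : ℚ))
            map_add' := fun e e' => hext _ _ fun x r => ?_
            map_smul' := fun s e => hext _ _ fun x r => ?_ }, fun k => hext _ _ fun x r => ?_⟩
  · refine (hc _ x r).trans ?_
    rw [smul_add, map_add, ← hc, ← hc]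
    rfl
  · refine (hc _ x r).trans ?_
    refine Eq.trans ?_ (congrArg (Finsupp.liftAddHom (c e))
      (Finsupp.smul_single s.unop x r)).symm
    rw [hc, smul_smul]
    rfl
  · refine (hc _ x r).trans ?_
    rw [← map_smul, hχ, map_smul, RightDual.smul_apply]
    simp

/-- Flat modules are `Ext`-orthogonal to character modules. -/
theorem IsRightFlat.extVanish_rightDual (hM : IsRightFlat R M) (Q : Type u) [AddCommGroup Q]
    [Module R Q] : ExtVanish Rᵐᵒᵖ M (RightDual R Q) := by
  intro E _ _ p hp f
  let γ : (Q →₀ R) →ₗ[R] Q := Finsupp.linearCombination R id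
  have hγ : Function.Surjective γ := Finsupp.linearCombination_id_surjective R Q
  let K := LinearMap.ker γ
  let i : K →ₗ[R] Q →₀ R := K.subtype
  obtain ⟨H, hH⟩ := RightDual.exists_extension_of_free Q (LinearMap.ker p).subtype
    (Submodule.injective_subtype _) (RightDual.map γ ∘ₗ f)
  obtain ⟨h, hh⟩ := exists_comp_eq_of_surjective p hp (RightDual.map (Q := K) i ∘ₗ H) fun e he => by
    have := hH ⟨e, he⟩
    rw [Submodule.subtype_apply] at this
    rw [LinearMap.comp_apply, this]
    refine RightDual.ext fun a => ?_
    change f ⟨e, he⟩ (γ a) = 0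
    rw [show γ a = 0 from a.2, map_zero]
  obtain ⟨h', hh'⟩ := hM.exists_lift (Q := K) i (Submodule.injective_subtype _) h
  obtain ⟨g, hg⟩ := RightDual.exists_lift_of_exact (A := K) i γ hγ (fun b hb => ⟨⟨b, hb⟩, rfl⟩)
    (H - h' ∘ₗ p) fun e => by
      rw [LinearMap.sub_apply, map_sub, sub_eq_zero]
      exact (hh e).symm.trans (DFunLike.congr_fun hh' (p e)).symm
  refine ⟨g, fun k => RightDual.map_injective γ hγ ?_⟩
  rw [hg, LinearMap.sub_apply, LinearMap.comp_apply, show p k = 0 from k.2, map_zero, sub_zero]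
  exact hH k

theorem isRightFlat_of_extVanish
    (H : ∀ (Q : Type u) [AddCommGroup Q] [Module R Q], ExtVanish Rᵐᵒᵖ M (RightDual R Q)) :
    IsRightFlat R M := by
  refine isRightFlat_of_exists_lift fun Q Q' _ _ _ _ f hf h => ?_
  let E : Submodule Rᵐᵒᵖ (M × RightDual R Q') :=
    LinearMap.eqLocus (h ∘ₗ LinearMap.fst _ _ _) (RightDual.map f ∘ₗ LinearMap.snd _ _ _)
  let p : E →ₗ[Rᵐᵒᵖ] M := LinearMap.fst _ _ _ ∘ₗ E.subtype
  let s : E →ₗ[Rᵐᵒᵖ] RightDual R Q' := LinearMap.snd _ _ _ ∘ₗ E.subtype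
  have hps : ∀ e : E, h (p e) = RightDual.map f (s e) := fun e => e.2
  have hp : Function.Surjective p := fun m => by
    obtain ⟨χ, hχ⟩ := exists_character_extension f.toAddMonoidHom hf
      (h m : Q →+ AddCircle (1 : ℚ))
    exact ⟨⟨(m, (χ : Q' →+ AddCircle (1 : ℚ))), RightDual.ext fun q => (hχ q).symm⟩, rfl⟩
  let π := (LinearMap.range f).mkQ
  have hπ : Function.Surjective π := Submodule.mkQ_surjective _
  obtain ⟨f₀, hf₀⟩ := RightDual.exists_lift_of_exact (E := LinearMap.ker p) f π hπ
    (fun b hb => (Submodule.Quotient.mk_eq_zero _).1 hb) (s ∘ₗ (LinearMap.ker p).subtype)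
    fun e => by
      rw [LinearMap.comp_apply, ← hps, Submodule.subtype_apply, show p e = 0 from e.2, map_zero]
  obtain ⟨g, hg⟩ := H _ E p hp f₀
  obtain ⟨h', hh'⟩ := exists_comp_eq_of_surjective p hp (s - RightDual.map π ∘ₗ g) fun e he => by
    have h1 : g e = f₀ ⟨e, he⟩ := hg ⟨e, he⟩
    refine sub_eq_zero.2 ?_
    rw [LinearMap.comp_apply (RightDual.map π), h1, hf₀]
    rfl
  refine ⟨h', LinearMap.ext fun m => ?_⟩
  obtain ⟨e, rfl⟩ := hp m
  rw [LinearMap.comp_apply, hh', LinearMap.sub_apply, map_sub, ← hps, sub_eq_self]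
  refine RightDual.ext fun q => ?_
  change g e (π (f q)) = 0
  rw [show π (f q) = 0 from (Submodule.Quotient.mk_eq_zero _).2 ⟨q, rfl⟩, map_zero]

end FlatExt

section KillsRelations

variable {S : Type u} [Ring S] {M : Type u} [AddCommGroup M] [Module S M]

/-- Every map from a free module to `M` that vanishes at `k` factors through a map of free modules
that vanishes at `k`. This is the equational criterion for flatness. -/
def KillsRelations (S : Type u) [Ring S] (M : Type u) [AddCommGroup M] [Module S M] : Prop :=
  ∀ (ι : Type u) (g : (ι →₀ S) →ₗ[S] M) (k : ι →₀ S), g k = 0 →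
    ∃ (κ : Type u) (v : (ι →₀ S) →ₗ[S] (κ →₀ S)) (h : (κ →₀ S) →ₗ[S] M),
      h ∘ₗ v = g ∧ v k = 0

namespace KillsRelations

theorem of_canonical (H : ∀ k : M →₀ S, Finsupp.linearCombination S id k = 0 →
    ∃ u : (M →₀ S) →ₗ[S] (M →₀ S), Finsupp.linearCombination S id ∘ₗ u =
      Finsupp.linearCombination S (id : M → M) ∧ u k = 0) : KillsRelations S M := by
  intro ι g k hk
  let φ : (ι →₀ S) →ₗ[S] (M →₀ S) := Finsupp.lmapDomain S S fun i => g (Finsupp.single i 1)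
  have hφ : Finsupp.linearCombination S (id : M → M) ∘ₗ φ = g := by
    ext i
    simp [φ]
  obtain ⟨u, hu, huk⟩ := H (φ k) (by rw [← LinearMap.comp_apply, hφ, hk])
  exact ⟨M, u ∘ₗ φ, Finsupp.linearCombination S id, by rw [← LinearMap.comp_assoc, hu, hφ], huk⟩

theorem exists_endomorphism (hM : KillsRelations S M) {ι : Type u} (π : (ι →₀ S) →ₗ[S] M)
    (hπ : Function.Surjective π) (X : Finset (ι →₀ S)) (hX : ∀ x ∈ X, π x = 0) :
    ∃ u : Module.End S (ι →₀ S), π ∘ₗ u = π ∧ ∀ x ∈ X, u x = 0 := by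
  classical
  induction X using Finset.induction_on with
  | empty => exact ⟨LinearMap.id, rfl, by simp⟩
  | insert k X _ ih =>
    obtain ⟨u, hu, huX⟩ := ih fun x hx => hX x (Finset.mem_insert_of_mem hx)
    obtain ⟨κ, v, h, hv, hk⟩ := hM ι π (u k) (by
      rw [← LinearMap.comp_apply, hu, hX k (Finset.mem_insert_self _ _)])
    obtain ⟨w, hw⟩ := Module.projective_lifting_property π h hπ
    refine ⟨(w ∘ₗ v) ∘ₗ u, ?_, fun x hx => ?_⟩
    · rw [← LinearMap.comp_assoc, ← LinearMap.comp_assoc, hw, hv, hu]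
    · rcases Finset.mem_insert.1 hx with rfl | hx
      · simp [hk]
      · simp [huX x hx]

theorem of_equiv {M' : Type u} [AddCommGroup M'] [Module S M'] (hM : KillsRelations S M)
    (e : M ≃ₗ[S] M') : KillsRelations S M' := by
  intro ι g k hk
  obtain ⟨κ, v, h, hv, hvk⟩ := hM ι (e.symm.toLinearMap ∘ₗ g) k (by simp [hk])
  refine ⟨κ, v, e.toLinearMap ∘ₗ h, ?_, hvk⟩
  rw [LinearMap.comp_assoc, hv]
  ext
  simp

/-- The criterion passes to quotients by submodules in which single linear equations can be
solved. -/
theorem quotient (hM : KillsRelations S M) (A : Submodule S M)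
    (hA : ∀ (ι : Type u) (k : ι →₀ S) (g : (ι →₀ S) →ₗ[S] M), g k ∈ A →
      ∃ g' : (ι →₀ S) →ₗ[S] M, (∀ x, g' x ∈ A) ∧ g' k = g k) : KillsRelations S (M ⧸ A) := by
  intro ι g k hk
  obtain ⟨g₀, rfl⟩ := Module.projective_lifting_property A.mkQ g A.mkQ_surjective
  obtain ⟨g', hg', hg'k⟩ := hA ι k g₀ ((Submodule.Quotient.mk_eq_zero A).1 hk)
  obtain ⟨κ, v, h, hv, hvk⟩ := hM ι (g₀ - g') k (by simp [hg'k])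
  refine ⟨κ, v, A.mkQ ∘ₗ h, ?_, hvk⟩
  rw [LinearMap.comp_assoc, hv]
  refine LinearMap.ext fun x => ?_
  rw [LinearMap.comp_apply, LinearMap.sub_apply, map_sub, LinearMap.comp_apply,
    sub_eq_self]
  exact (Submodule.Quotient.mk_eq_zero A).2 (hg' x)

theorem quotient_sSup (T : Set (Submodule S M)) (hne : T.Nonempty)
    (hT : DirectedOn (· ≤ ·) T) (H : ∀ A ∈ T, KillsRelations S (M ⧸ A)) :
    KillsRelations S (M ⧸ sSup T) := by
  intro ι g k hk
  obtain ⟨g₀, rfl⟩ := Module.projective_lifting_property (sSup T).mkQ g (sSup T).mkQ_surjective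
  obtain ⟨A, hA, hkA⟩ := (Submodule.mem_sSup_of_directed hne hT).1
    ((Submodule.Quotient.mk_eq_zero _).1 hk)
  obtain ⟨κ, v, h, hv, hvk⟩ := H A hA ι (A.mkQ ∘ₗ g₀) k
    ((Submodule.Quotient.mk_eq_zero A).2 hkA)
  refine ⟨κ, v, Submodule.factor (le_sSup hA) ∘ₗ h, ?_, hvk⟩
  rw [LinearMap.comp_assoc, hv, ← LinearMap.comp_assoc]
  rfl

end KillsRelations

end KillsRelations

section Flat

variable {R : Type u} [Ring R] {M : Type u} [AddCommGroup M] [Module Rᵐᵒᵖ M]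

private theorem mapRange_mem_closure_aux (k : M →₀ Rᵐᵒᵖ) (w : M →₀ M)
    (hw : w ∈ AddSubgroup.closure {w : M →₀ M | ∃ (y : M) (κ : M →₀ R),
      Finsupp.linearCombination R (fun m => (k m).unop) κ = 0 ∧
        ∀ m, w m = MulOpposite.op (κ m) • y}) :
    ∃ v : M → M →₀ Rᵐᵒᵖ, (∀ m, Finsupp.linearCombination Rᵐᵒᵖ id (v m) = w m) ∧
      Finsupp.linearCombination Rᵐᵒᵖ v k = 0 := by
  classical
  induction hw using AddSubgroup.closure_induction with
  | mem w hw =>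
    obtain ⟨y, κ, hκ, hw⟩ := hw
    refine ⟨fun m => Finsupp.single y (MulOpposite.op (κ m)), fun m => by simp [hw], ?_⟩
    have h1 : ∑ m ∈ k.support ∪ κ.support, κ m * (k m).unop = 0 := by
      rw [← hκ, Finsupp.linearCombination_apply, Finsupp.sum]
      refine (Finset.sum_subset Finset.subset_union_right fun m _ hm => ?_).symm
      simp [Finsupp.notMem_support_iff.1 hm]
    rw [Finsupp.linearCombination_apply, Finsupp.sum,
      Finset.sum_subset (Finset.subset_union_left (s₂ := κ.support)) fun m _ hm => by
        simp [Finsupp.notMem_support_iff.1 hm]]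
    simp only [Finsupp.smul_single]
    rw [← Finsupp.single_finsetSum, Finsupp.single_eq_zero]
    have h2 := congrArg (MulOpposite.opAddEquiv : R ≃+ Rᵐᵒᵖ) h1
    rw [map_zero, map_sum] at h2
    exact h2
  | zero => exact ⟨0, by simp, by simp⟩
  | add w w' _ _ h h' =>
    obtain ⟨v, h1, h2⟩ := h
    obtain ⟨v', h1', h2'⟩ := h'
    exact ⟨v + v', by simp [h1, h1'], by
      simp [Finsupp.linearCombination_apply, Finsupp.sum, smul_add, Finset.sum_add_distrib] at *
      simp [h2, h2']⟩
  | neg w _ h =>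
    obtain ⟨v, h1, h2⟩ := h
    exact ⟨-v, by simp [h1], by
      simp [Finsupp.linearCombination_apply, Finsupp.sum] at *
      simp [h2]⟩

theorem IsRightFlat.killsRelations (hM : IsRightFlat R M) : KillsRelations Rᵐᵒᵖ M := by
  classical
  refine KillsRelations.of_canonical fun k hk => ?_
  let f : (M →₀ R) →ₗ[R] R := Finsupp.linearCombination R fun m => (k m).unop
  let Q := LinearMap.range f
  let q : (M →₀ R) →ₗ[R] Q := f.rangeRestrict
  have hq : Function.Surjective q := f.surjective_rangeRestrict
  let Z : AddSubgroup (M →₀ M) := AddSubgroup.closure {w : M →₀ M | ∃ (y : M) (κ : M →₀ R),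
      f κ = 0 ∧ ∀ m, w m = MulOpposite.op (κ m) • y}
  let c : M → (M →₀ R) →+ (M →₀ M) := fun m => Finsupp.mapRange.addMonoidHom
    (AddMonoidHom.mk' (fun r => MulOpposite.op r • m) fun a b => by simp [add_smul])
  let c' : M → (M →₀ R) →+ (M →₀ M) ⧸ Z := fun m => (QuotientAddGroup.mk' Z).comp (c m)
  have hc' : ∀ m, q.toAddMonoidHom.ker ≤ (c' m).ker := fun m κ hκ => by
    refine (QuotientAddGroup.eq_zero_iff _).2 (AddSubgroup.subset_closure ⟨m, κ, ?_, fun _ => ?_⟩)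
    · exact congrArg Subtype.val (show q κ = 0 from hκ)
    · simp [c]
  let d : M → Q →+ (M →₀ M) ⧸ Z := fun m =>
    AddMonoidHom.liftOfSurjective q.toAddMonoidHom hq ⟨c' m, hc' m⟩
  have hd : ∀ m κ, d m (q κ) = QuotientAddGroup.mk' Z (c m κ) := fun m κ =>
    AddMonoidHom.liftOfRightInverse_comp_apply q.toAddMonoidHom _
      (Function.rightInverse_surjInv hq) ⟨c' m, hc' m⟩ κ
  let D : NCTensor R M Q →+ (M →₀ M) ⧸ Z := NCTensor.lift
    (AddMonoidHom.mk' d fun m m' => by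
      ext x
      obtain ⟨κ, rfl⟩ := hq x
      rw [AddMonoidHom.add_apply, hd, hd, hd, ← map_add]
      congr 1
      ext
      simp [c])
    (fun m r x => by
      obtain ⟨κ, rfl⟩ := hq x
      change d _ _ = d _ _
      rw [← map_smul, hd, hd]
      congr 1
      ext
      simp [c, smul_smul])
  let z : NCTensor R M Q := ∑ m ∈ k.support, NCTensor.tmul R m (q (Finsupp.single m 1))
  have hz : z = 0 := by
    refine hM Q R Q.subtype Q.injective_subtype ?_
    rw [map_zero, map_sum]
    have : ∀ m, NCTensor.map Q.subtype (NCTensor.tmul R m (q (Finsupp.single m 1))) =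
        NCTensor.tmul R (k m • m) (1 : R) := fun m => by
      rw [NCTensor.map_tmul, ← MulOpposite.op_unop (k m), NCTensor.smul_tmul]
      simp [q, f]
    rw [Finset.sum_congr rfl fun m _ => this m, ← NCTensor.sum_tmul]
    rw [Finsupp.linearCombination_apply, Finsupp.sum] at hk
    simp only [id] at hk
    rw [hk, NCTensor.zero_tmul]
  have hZ : ∑ m ∈ k.support, c m (Finsupp.single m 1) ∈ Z := by
    refine (QuotientAddGroup.eq_zero_iff _).1 ?_
    change QuotientAddGroup.mk' Z _ = 0
    have h1 := congrArg D hz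
    rw [map_zero, map_sum] at h1
    rw [map_sum, ← h1]
    exact Finset.sum_congr rfl fun m _ => (hd _ _).symm
  obtain ⟨v, hv, hvk⟩ := mapRange_mem_closure_aux k _ hZ
  have hv' : ∀ m ∈ k.support, Finsupp.linearCombination Rᵐᵒᵖ id (v m) = m := fun m hm => by
    rw [hv, Finsupp.finsetSum_apply, Finset.sum_eq_single_of_mem m hm]
    · simp [c]
    · intro m' _ hne
      simp [c, hne]
  refine ⟨Finsupp.linearCombination Rᵐᵒᵖ fun m => if m ∈ k.support then v m else
    Finsupp.single m 1, ?_, ?_⟩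
  · ext m
    by_cases hm : m ∈ k.support
    · simpa [Finsupp.mem_support_iff.1 hm] using hv' m hm
    · simp [Finsupp.notMem_support_iff.1 hm]
  · rw [← hvk, Finsupp.linearCombination_apply, Finsupp.linearCombination_apply]
    exact Finset.sum_congr rfl fun m hm => by simp only [if_pos hm]

end Flat

section CountableClosure

theorem exists_countable_closed {α : Type*} (o : Finset α → Set α) (ho : ∀ T, (o T).Countable)
    (x : α) : ∃ A : Set α, A.Countable ∧ x ∈ A ∧ ∀ T : Finset α, (T : Set α) ⊆ A → o T ⊆ A := by
  let A : ℕ → Set α := fun n => Nat.rec {x} (fun _ B => B ∪ ⋃ T ∈ {T : Finset α | ↑T ⊆ B}, o T) n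
  have hA : ∀ n, (A n).Countable := fun n => by
    induction n with
    | zero => exact Set.countable_singleton x
    | succ n ih =>
      refine ih.union (Set.Countable.biUnion ?_ fun T _ => ho T)
      refine ((Set.countable_ofPred_finite_subset ih).preimage
        (Finset.coe_injective (α := α))).mono fun T hT => ?_
      exact ⟨T.finite_toSet, hT⟩
  have hmono : Monotone A := monotone_nat_of_le_succ fun n => Set.subset_union_left
  refine ⟨⋃ n, A n, Set.countable_iUnion hA, Set.mem_iUnion.2 ⟨0, rfl⟩, fun T hT => ?_⟩
  obtain ⟨n, hn⟩ : ∃ n, (T : Set α) ⊆ A n :=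
    (hmono.directed_le).exists_mem_subset_of_finset_subset_biUnion hT
  exact fun y hy => Set.mem_iUnion.2 ⟨n + 1, Or.inr (Set.mem_biUnion hn hy)⟩

variable {S : Type u} [Ring S] [Countable S] {M : Type u} [AddCommGroup M] [Module S M]

theorem KillsRelations.exists_countable_submodule (hM : KillsRelations S M) (x₀ : M) :
    ∃ A : Submodule S M, x₀ ∈ A ∧ Countable A ∧ KillsRelations S A ∧ KillsRelations S (M ⧸ A) := by
  classical
  let π : (M →₀ S) →ₗ[S] M := Finsupp.linearCombination S id
  have hu : ∀ k : M →₀ S, ∃ u : Module.End S (M →₀ S), π ∘ₗ u = π ∧ (π k = 0 → u k = 0) := by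
    intro k
    by_cases hk : π k = 0
    · obtain ⟨u, h1, h2⟩ := hM.exists_endomorphism π (Finsupp.linearCombination_id_surjective S M)
        {k} (by simpa using hk)
      exact ⟨u, h1, fun _ => h2 k (by simp)⟩
    · exact ⟨LinearMap.id, rfl, fun h => absurd h hk⟩
  choose u hπu huk using hu
  have hh : ∀ (a : ℕ →₀ S) (y : M), ∃ h : ℕ → M, (∃ h₀, Finsupp.linearCombination S h₀ a = y) →
      Finsupp.linearCombination S h a = y := by
    intro a y
    by_cases h : ∃ h₀ : ℕ → M, Finsupp.linearCombination S h₀ a = y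
    · exact ⟨h.choose, fun _ => h.choose_spec⟩
    · exact ⟨0, fun h' => absurd h' h⟩
  choose h hh using hh
  let o : (M →₀ S) → M → Set M := fun k x =>
    {π k} ∪ ((u k (Finsupp.single x 1)).support ∪ ⋃ a : ℕ →₀ S, Set.range (h a x))
  have ho : ∀ k x, (o k x).Countable := fun k x => (Set.countable_singleton _).union
    ((Finset.countable_toSet _).union (Set.countable_iUnion fun a => Set.countable_range _))
  obtain ⟨A, hAc, hx₀, hA⟩ := exists_countable_closed
    (fun T => ⋃ c : T → S, ⋃ x : T, o (∑ t, Finsupp.single t.1 (c t)) x)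
    (fun T => Set.countable_iUnion fun c => Set.countable_iUnion fun x => ho _ _) x₀
  have hA' : ∀ (k : M →₀ S) (x : M), (k.support : Set M) ⊆ A → x ∈ A → o k x ⊆ A := by
    intro k x hk hx y hy
    refine hA (insert x k.support) (by simpa [Set.insert_subset_iff, hx] using hk)
      (Set.mem_iUnion.2 ⟨fun t => k t, Set.mem_iUnion.2 ⟨⟨x, by simp⟩, ?_⟩⟩)
    convert hy
    rw [Finset.sum_coe_sort (insert x k.support) fun t => Finsupp.single t (k t)]
    conv_rhs => rw [← Finsupp.sum_single k, Finsupp.sum]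
    refine (Finset.sum_subset (Finset.subset_insert _ _) fun t _ ht => ?_).symm
    simp [Finsupp.notMem_support_iff.1 ht]
  have hπA : ∀ k : M →₀ S, (k.support : Set M) ⊆ A → π k ∈ A := fun k hk =>
    hA' k x₀ hk hx₀ (Or.inl rfl)
  let B : Submodule S M :=
    { carrier := A
      zero_mem' := by simpa using hπA 0 (by simp)
      add_mem' := fun {a b} ha hb => by
        have := hπA (Finsupp.single a 1 + Finsupp.single b 1) fun y hy => by
          rcases Finset.mem_union.1 (Finsupp.support_add hy) with h | h
          · rw [Finset.mem_singleton.1 (Finsupp.support_single_subset h)]; exact ha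
          · rw [Finset.mem_singleton.1 (Finsupp.support_single_subset h)]; exact hb
        simpa [π] using this
      smul_mem' := fun c a ha => by
        have := hπA (Finsupp.single a c) fun y hy => by
          rw [Finset.mem_singleton.1 (Finsupp.support_single_subset hy)]; exact ha
        simpa [π] using this }
  refine ⟨B, hx₀, hAc, KillsRelations.of_canonical fun k hk => ?_,
    hM.quotient B fun ι k g hg => ?_⟩
  · let φ : (B →₀ S) →ₗ[S] (M →₀ S) := Finsupp.lmapDomain S S Subtype.val
    have hφ : ∀ k, π (φ k) = (Finsupp.linearCombination S id k : B) := fun k => by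
      have : π ∘ₗ φ = B.subtype ∘ₗ Finsupp.linearCombination S id := by
        ext
        simp [π, φ]
      exact congr($this k)
    have hsupp : ((φ k).support : Set M) ⊆ A := fun y hy => by
      obtain ⟨b, -, rfl⟩ := Finset.mem_image.1 (Finsupp.mapDomain_support hy)
      exact b.2
    let ψ : (M →₀ S) →ₗ[S] (B →₀ S) := Finsupp.lsubtypeDomain (B : Set M)
    have hψ : ∀ w : M →₀ S, (w.support : Set M) ⊆ A →
        ((Finsupp.linearCombination S id (ψ w) : B) : M) = π w := fun w hw => by
      rw [Finsupp.linearCombination_apply, Finsupp.sum, Submodule.coe_sum]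
      exact Finsupp.sum_subtypeDomain_index (p := fun m => m ∈ (B : Set M))
        (h := fun (m : M) (s : S) => s • m) hw
    refine ⟨ψ ∘ₗ u (φ k) ∘ₗ φ, ?_, ?_⟩
    · ext b
      refine (hψ _ ?_).trans ?_
      · have : φ (Finsupp.single b 1) = Finsupp.single b.1 1 := by simp [φ]
        simp only [LinearMap.comp_apply, Finsupp.lsingle_apply, this]
        exact fun y hy => hA' (φ k) b hsupp b.2 (Or.inr (Or.inl hy))
      · have := congr($(hπu (φ k)) (φ (Finsupp.single b 1)))
        refine this.trans ?_
        simp [hφ]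
    · have : u (φ k) (φ k) = 0 := huk _ (by rw [hφ, hk]; rfl)
      simp [this]
  · obtain ⟨e, he⟩ : ∃ e : ι → ℕ, Set.InjOn e k.support :=
      Set.countable_iff_exists_injOn.1 (Finset.countable_toSet _)
    by_cases hι : Nonempty ι
    swap
    · exact ⟨0, by simp, by
        have : IsEmpty ι := not_nonempty_iff.1 hι
        rw [Subsingleton.elim k 0]; simp⟩
    have h₁ := hh (k.mapDomain e) (g k)
      ⟨fun n => g (Finsupp.single (Function.invFunOn e k.support n) 1), by
        rw [Finsupp.linearCombination_mapDomain, Finsupp.linearCombination_apply]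
        conv_rhs => rw [← Finsupp.sum_single k, Finsupp.sum, map_sum]
        refine Finset.sum_congr rfl fun i hi => ?_
        simp only [Function.comp_apply]
        rw [he.leftInvOn_invFunOn hi, ← map_smul]
        simp⟩
    refine ⟨Finsupp.linearCombination S (h (k.mapDomain e) (g k) ∘ e), fun y => ?_, ?_⟩
    · rw [Finsupp.linearCombination_apply]
      refine B.sum_mem fun i _ => B.smul_mem _ ?_
      exact hA' 0 (g k) (by simp) hg (Or.inr (Or.inr (Set.mem_iUnion.2 ⟨_, ⟨e i, rfl⟩⟩)))
    · rw [← Finsupp.linearCombination_mapDomain, h₁]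

end CountableClosure

section Filtration

variable {S : Type u} [Ring S] [Countable S] {M : Type u} [AddCommGroup M] [Module S M]

/-- Modules satisfying the equational criterion are filtered by countable ones, so `ExtVanish`
for them reduces to the countable case. -/
theorem KillsRelations.extVanish_of_countable (hM : KillsRelations S M) (C : Type u)
    [AddCommGroup C] [Module S C]
    (H : ∀ (N : Type u) [AddCommGroup N] [Module S N] [Countable N], KillsRelations S N →
      ExtVanish S N C) : ExtVanish S M C := by
  intro E _ _ p hp f
  let f₀ : E →ₗ.[S] C := ⟨LinearMap.ker p, f⟩
  let P : Set (E →ₗ.[S] C) := {g | f₀ ≤ g ∧ KillsRelations S (E ⧸ g.domain)}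
  obtain ⟨g, hfg, hg⟩ := zorn_le_nonempty₀ P (fun c hc hchain y hy => by
    have hdir : DirectedOn (· ≤ ·) c := hchain.directedOn
    refine ⟨LinearPMap.sSup c hdir, ⟨(hc hy).1.trans (LinearPMap.le_sSup hdir hy), ?_⟩,
      fun z hz => LinearPMap.le_sSup hdir hz⟩
    have := KillsRelations.quotient_sSup (LinearPMap.domain '' c) ⟨_, y, hy, rfl⟩
      (DirectedOn.mono_comp LinearPMap.domain_mono.monotone hdir) (by
        rintro _ ⟨z, hz, rfl⟩
        exact (hc hz).2)
    exact this) f₀ ⟨le_rfl, hM.of_equiv (p.quotKerEquivOfSurjective hp).symm⟩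
  suffices htop : g.domain = ⊤ by
    refine ⟨g.toFun ∘ₗ LinearMap.codRestrict g.domain LinearMap.id (by simp [htop]), fun k => ?_⟩
    exact (hfg.2 (x := k) (y := ⟨k, hfg.1 k.2⟩) rfl).symm
  by_contra hne
  obtain ⟨x, hx⟩ : ∃ x, x ∉ g.domain := by
    by_contra! h
    exact hne (eq_top_iff.2 fun x _ => h x)
  obtain ⟨A, hxA, hAc, hA, hEA⟩ := hg.prop.2.exists_countable_submodule (g.domain.mkQ x)
  let N := A.comap g.domain.mkQ
  have hN : N.map g.domain.mkQ = A :=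
    Submodule.map_comap_eq_of_surjective g.domain.mkQ_surjective A
  have hle : g.domain ≤ N := fun y hy => by
    change g.domain.mkQ y ∈ A
    rw [Submodule.mkQ_apply, (Submodule.Quotient.mk_eq_zero _).2 hy]
    exact A.zero_mem
  let q : N →ₗ[S] A := g.domain.mkQ.restrict fun y hy => hy
  have hq : Function.Surjective q := fun a => by
    obtain ⟨y, hy⟩ := g.domain.mkQ_surjective a
    exact ⟨⟨y, by change g.domain.mkQ y ∈ A; rw [hy]; exact a.2⟩, Subtype.ext hy⟩
  have hqk : ∀ k : LinearMap.ker q, (k : N).1 ∈ g.domain := fun k =>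
    (Submodule.Quotient.mk_eq_zero _).1 congr(Subtype.val $(k.2))
  obtain ⟨g', hg'⟩ := H A hA N q hq
    (g.toFun ∘ₗ LinearMap.codRestrict g.domain (N.subtype ∘ₗ (LinearMap.ker q).subtype) hqk)
  let G : E →ₗ.[S] C := ⟨N, g'⟩
  have hgG : g ≤ G := ⟨hle, fun y z hyz => by
    have hz : z ∈ LinearMap.ker q := Subtype.ext
      ((Submodule.Quotient.mk_eq_zero _).2 (show z.1 ∈ g.domain from hyz ▸ y.2))
    refine Eq.trans ?_ (hg' ⟨z, hz⟩).symm
    exact congrArg g.toFun (Subtype.ext hyz)⟩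
  have hG : G ∈ P := ⟨hfg.trans hgG, by
    refine KillsRelations.of_equiv ?_ (Submodule.quotientQuotientEquivQuotient g.domain N hle)
    rw [hN]
    exact hEA⟩
  exact hx ((hg.le_of_ge hG hgG).1 (show x ∈ N from hxA))

end Filtration

section Telescope

variable {S : Type u} [Ring S] {F : Type u} [AddCommGroup F] [Module S F]

/-- The transition map `F_n → F_{n + j}` of the telescope `F → F → ⋯` with bonding maps `u`. -/
noncomputable def transition (u : ℕ → Module.End S F) (n : ℕ) : ℕ → Module.End S F
  | 0 => 1
  | j + 1 => u (n + j) * transition u n j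

theorem transition_succ' (u : ℕ → Module.End S F) (n j : ℕ) :
    transition u n (j + 1) = transition u (n + 1) j * u n := by
  induction j with
  | zero => simp [transition]
  | succ j ih =>
    rw [transition, ih, transition, mul_assoc, Nat.add_right_comm n 1 j, Nat.add_assoc n j 1]

variable {N : Type u} [AddCommGroup N] [Module S N]

/-- A countable module satisfying the equational criterion is a telescope of free modules. -/
theorem KillsRelations.exists_telescope {ι : Type u} [Countable (ι →₀ S)]
    (hN : KillsRelations S N) (π : (ι →₀ S) →ₗ[S] N) (hπ : Function.Surjective π) :
    ∃ u : ℕ → Module.End S (ι →₀ S), (∀ n, π ∘ₗ u n = π) ∧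
      ∀ x, π x = 0 → ∀ n, ∃ j, transition u n j x = 0 := by
  classical
  obtain ⟨k, hk⟩ := exists_surjective_nat (LinearMap.ker π)
  have hT : ∀ Y : Finset (ι →₀ S), ∃ T : Module.End S (ι →₀ S), π ∘ₗ T = π ∧
      ((∀ y ∈ Y, π y = 0) → ∀ y ∈ Y, T y = 0) := fun Y => by
    by_cases hY : ∀ y ∈ Y, π y = 0
    · obtain ⟨T, h1, h2⟩ := hN.exists_endomorphism π hπ Y hY
      exact ⟨T, h1, fun _ => h2⟩
    · exact ⟨1, rfl, fun h => absurd h hY⟩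
  choose T hTπ hTY using hT
  let U : ℕ → Finset (Module.End S (ι →₀ S)) → Module.End S (ι →₀ S) := fun m P =>
    T ((P ×ˢ Finset.range (m + 1)).image fun w => w.1 (k w.2))
  let P : ℕ → Finset (Module.End S (ι →₀ S)) := fun m =>
    Nat.rec {1} (fun m P => insert 1 (P.image fun w => U m P * w)) m
  let u : ℕ → Module.End S (ι →₀ S) := fun m => U m (P m)
  have hP : ∀ m, P (m + 1) = insert 1 ((P m).image fun w => u m * w) := fun _ => rfl
  have hu : ∀ n, π ∘ₗ u n = π := fun n => hTπ _
  have hPπ : ∀ m, ∀ w ∈ P m, π ∘ₗ w = π := fun m => by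
    induction m with
    | zero =>
      intro w hw
      rw [Finset.mem_singleton.1 hw]
      rfl
    | succ m ih =>
      intro w hw
      rcases Finset.mem_insert.1 (hP m ▸ hw) with rfl | hw'
      · rfl
      · obtain ⟨w, hwm, rfl⟩ := Finset.mem_image.1 hw'
        rw [Module.End.mul_eq_comp, ← LinearMap.comp_assoc, hu, ih w hwm]
  have htr : ∀ n j, transition u n j ∈ P (n + j) := fun n j => by
    induction j with
    | zero =>
      cases n with
      | zero => exact Finset.mem_singleton_self _
      | succ n => exact Finset.mem_insert_self _ _
    | succ j ih => exact Finset.mem_insert_of_mem (Finset.mem_image_of_mem _ ih)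
  refine ⟨u, hu, fun x hx n => ?_⟩
  obtain ⟨i, hi⟩ := hk ⟨x, hx⟩
  refine ⟨i + 1, hTY _ (fun y hy => ?_) _ (Finset.mem_image.2
    ⟨(transition u n i, i), Finset.mem_product.2 ⟨htr n i, by simp⟩, by simp [hi]⟩)⟩
  obtain ⟨⟨w, i'⟩, hw, rfl⟩ := Finset.mem_image.1 hy
  exact (congr($(hPπ _ w (Finset.mem_product.1 hw).1) (k i').1)).trans (k i').2

/-- The extension problem for the colimit of a telescope of projectives reduces to a system of
recursive equations. -/
theorem ExtVanish.of_telescope [Module.Free S F] {C : Type u} [AddCommGroup C] [Module S C]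
    (π : F →ₗ[S] N) (hπ : Function.Surjective π) (u : ℕ → Module.End S F)
    (hu : ∀ n, π ∘ₗ u n = π) (hk : ∀ x, π x = 0 → ∀ n, ∃ j, transition u n j x = 0)
    (H : ∀ c : ℕ → F →ₗ[S] C, ∃ d : ℕ → F →ₗ[S] C, ∀ n, d n - d (n + 1) ∘ₗ u n = c n) :
    ExtVanish S N C := by
  let q : (ℕ →₀ F) →ₗ[S] N := Finsupp.lsum ℕ fun _ => π
  let V : (ℕ →₀ F) →ₗ[S] (ℕ →₀ F) :=
    Finsupp.lsum ℕ fun n => Finsupp.lsingle n - Finsupp.lsingle (n + 1) ∘ₗ u n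
  have hq : ∀ n x, q (Finsupp.single n x) = π x := fun n x => by simp [q]
  have hV : ∀ n x, V (Finsupp.single n x) = Finsupp.single n x - Finsupp.single (n + 1) (u n x) :=
    fun n x => by simp [V]
  have hqV : q ∘ₗ V = 0 := by
    ext n x
    have h1 : π (u n x) = π x := congr($(hu n) x)
    simp [hV, hq, h1]
  have htr : ∀ j n x, Finsupp.single n x - Finsupp.single (n + j) (transition u n j x) ∈
      LinearMap.range V := fun j => by
    induction j with
    | zero =>
      intro n x
      simp [transition]
    | succ j ih =>
      intro n x
      have h2 := (LinearMap.range V).add_mem ⟨_, hV n x⟩ (ih (n + 1) (u n x))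
      rw [sub_add_sub_cancel, ← Module.End.mul_apply, ← transition_succ'] at h2
      rwa [Nat.add_right_comm n 1 j, Nat.add_assoc n j 1] at h2
  have hred : ∀ y : ℕ →₀ F, ∃ m x, y - Finsupp.single m x ∈ LinearMap.range V := fun y => by
    induction y using Finsupp.induction_linear with
    | zero => exact ⟨0, 0, by simp⟩
    | add y y' h h' =>
      obtain ⟨m, x, h⟩ := h
      obtain ⟨m', x', h'⟩ := h'
      refine ⟨m + m', transition u m m' x + transition u m' m x', ?_⟩
      have h1 := add_mem (add_mem h (htr m' m x)) (add_mem h' (htr m m' x'))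
      rw [sub_add_sub_cancel, sub_add_sub_cancel, Nat.add_comm m' m, sub_add_sub_comm,
        ← Finsupp.single_add] at h1
      exact h1
    | single a b => exact ⟨a, b, by simp⟩
  have hker : ∀ y, q y = 0 → y ∈ LinearMap.range V := fun y hy => by
    obtain ⟨m, x, hx⟩ := hred y
    have hπx : π x = 0 := by
      obtain ⟨w, hw⟩ := hx
      have h1 := congr($hqV w)
      rw [LinearMap.comp_apply, hw, map_sub, hy] at h1
      simpa [hq] using h1
    obtain ⟨j, hj⟩ := hk x hπx m
    have := add_mem hx (htr j m x)
    simpa [hj] using this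
  refine ExtVanish.of_presentation q (fun n => ?_) fun f => ?_
  · obtain ⟨x, rfl⟩ := hπ n
    exact ⟨Finsupp.single 0 x, hq 0 x⟩
  · let V' : (ℕ →₀ F) →ₗ[S] LinearMap.ker q := V.codRestrict _ fun w => congr($hqV w)
    obtain ⟨d, hd⟩ := H fun n => f ∘ₗ V' ∘ₗ Finsupp.lsingle n
    let g : (ℕ →₀ F) →ₗ[S] C := Finsupp.lsum ℕ d
    have hgs : ∀ n x, g (Finsupp.single n x) = d n x := fun n x => by simp [g]
    have hg : g ∘ₗ V = f ∘ₗ V' := by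
      ext n x
      have h1 : d n x - d (n + 1) (u n x) = f (V' (Finsupp.single n x)) := congr($(hd n) x)
      simp [← h1, hV, hgs]
    refine ⟨g, fun k => ?_⟩
    obtain ⟨w, hw⟩ := hker k k.2
    have h1 : V' w = k := Subtype.ext hw
    rw [← hw, ← h1]
    exact congr($hg w)

end Telescope

section TreeModule

theorem LocallyProjective.of_free_factor {S : Type u} [Ring S] {M : Type u} [AddCommGroup M]
    [Module S M] (h : ∀ X : Finset M, ∃ (P : Type u) (_ : AddCommGroup P) (_ : Module S P)
      (_ : Module.Free S P) (a : M →ₗ[S] P) (b : P →ₗ[S] M), ∀ m ∈ X, b (a m) = m) :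
    LocallyProjective S M := by
  refine LocallyProjective.of_factor fun X => ?_
  obtain ⟨P, _, _, _, a, b, hab⟩ := h X
  let e := (Module.Free.chooseBasis S P).repr
  exact ⟨_, e.toLinearMap ∘ₗ a, b ∘ₗ e.symm.toLinearMap, fun m hm => by simp [hab m hm]⟩

variable {K : Type u}

/-- The initial segment of length `n` of a branch. -/
def initialSegment (s : ℕ → K) (n : ℕ) : List K := (List.range n).map s

@[simp]
theorem length_initialSegment (s : ℕ → K) (n : ℕ) : (initialSegment s n).length = n := by
  simp [initialSegment]

theorem initialSegment_inj {s s' : ℕ → K} {n : ℕ} :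
    initialSegment s n = initialSegment s' n ↔ ∀ i < n, s i = s' i := by
  simp [initialSegment]

/-- Finitely many branches are pairwise distinct at high levels. -/
theorem exists_injOn_initialSegment (A : Finset (ℕ → K)) :
    ∃ n, ∀ m ≥ n, Set.InjOn (initialSegment · m) (A : Set (ℕ → K)) := by
  classical
  have h : ∀ p : (ℕ → K) × (ℕ → K), ∃ n, p.1 ≠ p.2 → p.1 n ≠ p.2 n := fun p => by
    by_cases h : p.1 = p.2
    · exact ⟨0, fun h' => absurd h h'⟩
    · obtain ⟨n, hn⟩ := Function.ne_iff.1 h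
      exact ⟨n, fun _ => hn⟩
  choose n hn using h
  refine ⟨(A ×ˢ A).sup n + 1, fun m hm s hs s' hs' hss' => by_contra fun hne => ?_⟩
  refine hn (s, s') hne (initialSegment_inj.1 hss' _ ?_)
  exact (Finset.le_sup (f := n) (Finset.mem_product.2 ⟨hs, hs'⟩)).trans_lt
    (Nat.lt_of_succ_le hm)

variable {S : Type u} [Ring S] {F : Type u} [AddCommGroup F] [Module S F]

variable (K) in
/-- The relations of the tree module: the generator `(s, n)` attached to a branch `s` at level `n`
is identified with the sum of the image of the next generator and the node `s|n`. -/
noncomputable def treeRelation (u : ℕ → Module.End S F) :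
    ((ℕ → K) × ℕ →₀ F) →ₗ[S] ((ℕ → K) × ℕ →₀ F) × (List K →₀ F) :=
  (Finsupp.lsum ℕ fun p => Finsupp.lsingle p - Finsupp.lsingle (p.1, p.2 + 1) ∘ₗ u p.2).prod
    (Finsupp.lsum ℕ fun p => -Finsupp.lsingle (initialSegment p.1 p.2))

theorem treeRelation_single (u : ℕ → Module.End S F) (s : ℕ → K) (n : ℕ) (x : F) :
    treeRelation K u (Finsupp.single (s, n) x) =
      (Finsupp.single (s, n) x - Finsupp.single (s, n + 1) (u n x),
        -Finsupp.single (initialSegment s n) x) := by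
  simp [treeRelation]

theorem treeRelation_injective (u : ℕ → Module.End S F) :
    Function.Injective (treeRelation K u) := by
  rw [injective_iff_map_eq_zero]
  intro y hy
  have h0 : ∀ s, Finsupp.lapply (s, 0) ∘ₗ LinearMap.fst S _ _ ∘ₗ treeRelation K u =
      Finsupp.lapply (s, 0) := fun s => by
    ext ⟨s', n⟩ x
    simp [treeRelation_single]
  have h1 : ∀ s n, Finsupp.lapply (s, n + 1) ∘ₗ LinearMap.fst S _ _ ∘ₗ treeRelation K u =
      Finsupp.lapply (s, n + 1) - u n ∘ₗ Finsupp.lapply (s, n) := fun s n => by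
    classical
    ext ⟨s', n'⟩ x
    by_cases h : s' = s ∧ n' = n
    · obtain ⟨rfl, rfl⟩ := h
      simp [treeRelation_single]
    · simp [treeRelation_single, Finsupp.single_apply, h]
  ext ⟨s, n⟩
  induction n with
  | zero =>
    have := congr($(h0 s) y)
    simpa [hy] using this.symm
  | succ n ih =>
    have := congr($(h1 s n) y)
    simpa [hy, ih] using this.symm

variable (K) in
/-- The tree module attached to the telescope with bonding maps `u` and the tree of finite
sequences in `K`. -/
abbrev TreeModule (u : ℕ → Module.End S F) : Type u :=
  (((ℕ → K) × ℕ →₀ F) × (List K →₀ F)) ⧸ LinearMap.range (treeRelation K u)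

namespace TreeModule

variable (u : ℕ → Module.End S F)

/-- The `n`-th generator of a branch. -/
noncomputable def branch (s : ℕ → K) (n : ℕ) : F →ₗ[S] TreeModule K u :=
  (LinearMap.range (treeRelation K u)).mkQ ∘ₗ LinearMap.inl S _ _ ∘ₗ Finsupp.lsingle (s, n)

/-- The generator of a node. -/
noncomputable def node (t : List K) : F →ₗ[S] TreeModule K u :=
  (LinearMap.range (treeRelation K u)).mkQ ∘ₗ LinearMap.inr S _ _ ∘ₗ Finsupp.lsingle t

theorem branch_eq (s : ℕ → K) (n : ℕ) (x : F) :
    branch u s n x = branch u s (n + 1) (u n x) + node u (initialSegment s n) x := by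
  rw [← sub_eq_zero, branch, branch, node]
  simp only [LinearMap.comp_apply, ← map_add, ← map_sub]
  refine (Submodule.Quotient.mk_eq_zero _).2 ⟨Finsupp.single (s, n) x, ?_⟩
  rw [treeRelation_single]
  simp

theorem induction {p : TreeModule K u → Prop} (hb : ∀ s n x, p (branch u s n x))
    (hn : ∀ t x, p (node u t x)) (ha : ∀ x y, p x → p y → p (x + y)) (h0 : p 0)
    (z : TreeModule K u) : p z := by
  obtain ⟨⟨y, w⟩, rfl⟩ := Submodule.mkQ_surjective _ z
  have h1 : ∀ y, p ((LinearMap.range (treeRelation K u)).mkQ (LinearMap.inl S _ _ y)) := fun y => by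
    induction y using Finsupp.induction_linear with
    | zero => rwa [map_zero, map_zero]
    | add y y' h h' => rw [map_add, map_add]; exact ha _ _ h h'
    | single a b => exact hb a.1 a.2 b
  have h2 : ∀ w, p ((LinearMap.range (treeRelation K u)).mkQ (LinearMap.inr S _ _ w)) := fun w => by
    induction w using Finsupp.induction_linear with
    | zero => rwa [map_zero, map_zero]
    | add w w' h h' => rw [map_add, map_add]; exact ha _ _ h h'
    | single a b => exact hn a b
  have := ha _ _ (h1 y) (h2 w)
  rwa [← map_add, LinearMap.inl_apply, LinearMap.inr_apply, Prod.mk_add_mk, add_zero,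
    zero_add] at this

open Classical in
/-- The realization of the generators of the branches in the product of copies of `F` over all
nodes. -/
noncomputable def branchToPi : ((ℕ → K) × ℕ →₀ F) →ₗ[S] (List K → F) :=
  Finsupp.lsum ℕ fun p => LinearMap.pi fun t =>
    if t = initialSegment p.1 t.length ∧ p.2 ≤ t.length
      then transition u p.2 (t.length - p.2) else 0

open Classical in
theorem branchToPi_single (s : ℕ → K) (n : ℕ) (x : F) (t : List K) :
    branchToPi u (Finsupp.single (s, n) x) t = if t = initialSegment s t.length ∧ n ≤ t.length
      then transition u n (t.length - n) x else 0 := by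
  rw [branchToPi, Finsupp.lsum_single, LinearMap.pi_apply]
  split_ifs <;> rfl

open Classical in
theorem branchToPi_sub (s : ℕ → K) (n : ℕ) (x : F) (t : List K) :
    branchToPi u (Finsupp.single (s, n) x) t - branchToPi u (Finsupp.single (s, n + 1) (u n x)) t =
      if t = initialSegment s n then x else 0 := by
  rw [branchToPi_single, branchToPi_single]
  by_cases ht : t = initialSegment s t.length
  · rcases lt_trichotomy n t.length with h | rfl | h
    · obtain ⟨j, hj⟩ := Nat.exists_eq_add_of_lt h
      have h1 : t.length - n = j + 1 := by omega
      have h2 : t.length - (n + 1) = j := by omega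
      rw [if_pos ⟨ht, h.le⟩, if_pos ⟨ht, h⟩, h1, h2, transition_succ', Module.End.mul_apply,
        sub_self, if_neg]
      rintro rfl
      simp at h
    · rw [if_pos ⟨ht, le_rfl⟩, if_neg (by simp), if_pos ht, Nat.sub_self, sub_zero]
      rfl
    · rw [if_neg (by omega), if_neg (by omega), if_neg, sub_self]
      rintro rfl
      simp at h
  · rw [if_neg (fun h => ht h.1), if_neg (fun h => ht h.1), if_neg, sub_self]
    rintro rfl
    simp at ht

/-- The realization of the tree module inside the product of copies of `F` over all nodes. -/
noncomputable def toPi : TreeModule K u →ₗ[S] (List K → F) :=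
  (LinearMap.range (treeRelation K u)).liftQ
    ((branchToPi u).coprod (Finsupp.lcoeFun (R := S))) (by
    classical
    rw [LinearMap.range_le_ker_iff]
    refine Finsupp.lhom_ext fun p x => ?_
    obtain ⟨s, n⟩ := p
    rw [LinearMap.comp_apply, treeRelation_single, LinearMap.coprod_apply, map_sub]
    funext t
    rw [Pi.add_apply, Pi.sub_apply, branchToPi_sub, map_neg, Pi.neg_apply, Finsupp.lcoeFun_apply,
      Finsupp.single_apply]
    simp [eq_comm])

open Classical in
theorem toPi_branch (s : ℕ → K) (n : ℕ) (x : F) (t : List K) :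
    toPi u (branch u s n x) t = if t = initialSegment s t.length ∧ n ≤ t.length
      then transition u n (t.length - n) x else 0 := by
  rw [← branchToPi_single]
  refine (congrFun (Submodule.liftQ_apply _ _ _) t).trans ?_
  simp

open Classical in
theorem toPi_node (t t' : List K) (x : F) :
    toPi u (node u t x) t' = if t' = t then x else 0 := by
  refine (congrFun (Submodule.liftQ_apply _ _ _) t').trans ?_
  simp [Finsupp.single_apply, eq_comm]

theorem exists_bound_of_finset (X : Finset (TreeModule K u)) :
    ∃ (A₀ : Finset (ℕ → K)) (m₀ : ℕ) (T₀ : Finset (List K)), ∀ m ≥ m₀,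
      ∀ Φ : Submodule S (TreeModule K u), (∀ s ∈ A₀, ∀ x, branch u s m x ∈ Φ) →
        (∀ t ∈ T₀, t.length < m → ∀ x, node u t x ∈ Φ) →
        (∀ s ∈ A₀, ∀ j < m, ∀ x, node u (initialSegment s j) x ∈ Φ) → ∀ z ∈ X, z ∈ Φ := by
  classical
  have key : ∀ z : TreeModule K u, ∃ (A₀ : Finset (ℕ → K)) (m₀ : ℕ) (T₀ : Finset (List K)),
      ∀ m ≥ m₀, ∀ Φ : Submodule S (TreeModule K u), (∀ s ∈ A₀, ∀ x, branch u s m x ∈ Φ) →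
        (∀ t ∈ T₀, t.length < m → ∀ x, node u t x ∈ Φ) →
        (∀ s ∈ A₀, ∀ j < m, ∀ x, node u (initialSegment s j) x ∈ Φ) → z ∈ Φ := by
    intro z
    induction z using TreeModule.induction with
    | hb s n x =>
      refine ⟨{s}, n, ∅, fun m hm Φ h1 h2 h3 => ?_⟩
      clear h2
      replace h1 := h1 s (Finset.mem_singleton_self s)
      replace h3 := h3 s (Finset.mem_singleton_self s)
      induction m, hm using Nat.le_induction generalizing Φ with
      | base => exact h1 x
      | succ m hm ih =>
        refine ih Φ (fun y => ?_) fun j hj => h3 j (hj.trans (Nat.lt_succ_self m))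
        rw [branch_eq]
        exact Φ.add_mem (h1 _) (h3 m (Nat.lt_succ_self m) y)
    | hn t x =>
      exact ⟨∅, t.length + 1, {t}, fun m hm Φ _ h2 _ => h2 t (by simp) hm x⟩
    | ha y z hy hz =>
      obtain ⟨A, m₀, T, h⟩ := hy
      obtain ⟨A', m₀', T', h'⟩ := hz
      refine ⟨A ∪ A', max m₀ m₀', T ∪ T', fun m hm Φ h1 h2 h3 => Φ.add_mem ?_ ?_⟩
      · exact h m (le_of_max_le_left hm) Φ (fun s hs => h1 s (Finset.mem_union_left _ hs))
          (fun t ht => h2 t (Finset.mem_union_left _ ht))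
          fun s hs => h3 s (Finset.mem_union_left _ hs)
      · exact h' m (le_of_max_le_right hm) Φ (fun s hs => h1 s (Finset.mem_union_right _ hs))
          (fun t ht => h2 t (Finset.mem_union_right _ ht))
          fun s hs => h3 s (Finset.mem_union_right _ hs)
    | h0 => exact ⟨∅, 0, ∅, fun m _ Φ _ _ _ => Φ.zero_mem⟩
  choose A m₀ T h using key
  refine ⟨X.biUnion A, X.sup m₀, X.biUnion T, fun m hm Φ h1 h2 h3 z hz => ?_⟩
  exact h z m ((Finset.le_sup hz).trans hm) Φ
    (fun s hs => h1 s (Finset.mem_biUnion.2 ⟨z, hz, hs⟩))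
    (fun t ht => h2 t (Finset.mem_biUnion.2 ⟨z, hz, ht⟩))
    fun s hs => h3 s (Finset.mem_biUnion.2 ⟨z, hz, hs⟩)

theorem locallyProjective [Module.Free S F] : LocallyProjective S (TreeModule K u) := by
  classical
  refine LocallyProjective.of_free_factor fun X => ?_
  obtain ⟨A, m₀, T, h⟩ := exists_bound_of_finset u X
  obtain ⟨m₁, hm₁⟩ := exists_injOn_initialSegment A
  obtain ⟨m, hm₀, hm₁⟩ : ∃ m ≥ m₀, Set.InjOn (initialSegment · m) (A : Set (ℕ → K)) :=
    ⟨max m₀ m₁, le_max_left _ _, hm₁ _ (le_max_right _ _)⟩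
  let Θ : Finset (List K) := T.filter (·.length < m) ∪
    (A ×ˢ Finset.range (m + 1)).image fun p => initialSegment p.1 p.2
  let β : List K → F →ₗ[S] TreeModule K u := fun t => if t.length < m then node u t else
    if h : ∃ s ∈ A, initialSegment s m = t then branch u h.choose m else 0
  have hβ : ∀ s ∈ A, β (initialSegment s m) = branch u s m := fun s hs => by
    have hex : ∃ s' ∈ A, initialSegment s' m = initialSegment s m := ⟨s, hs, rfl⟩
    have h1 : hex.choose = s := hm₁ hex.choose_spec.1 hs hex.choose_spec.2
    simp only [β, length_initialSegment, lt_irrefl, if_false, dif_pos hex, h1]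
  let a : TreeModule K u →ₗ[S] (List K →₀ F) :=
    ∑ t ∈ Θ, Finsupp.lsingle t ∘ₗ LinearMap.proj t ∘ₗ toPi u
  let b : (List K →₀ F) →ₗ[S] TreeModule K u := Finsupp.lsum ℕ β
  have hba : ∀ z, b (a z) = ∑ t ∈ Θ, β t (toPi u z t) := fun z => by simp [a, b]
  have hnode : ∀ t ∈ Θ, t.length < m → ∀ x, b (a (node u t x)) = node u t x := by
    intro t ht hlt x
    rw [hba, Finset.sum_eq_single_of_mem t ht fun t' _ hne => by simp [toPi_node, hne]]
    simp [toPi_node, β, hlt]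
  have hlen : ∀ t ∈ Θ, m ≤ t.length → ∃ s ∈ A, initialSegment s m = t := fun t ht hle => by
    rcases Finset.mem_union.1 ht with ht | ht
    · exact absurd (Finset.mem_filter.1 ht).2 (not_lt.2 hle)
    · obtain ⟨⟨s, j⟩, hp, rfl⟩ := Finset.mem_image.1 ht
      obtain ⟨hs, hj⟩ := Finset.mem_product.1 hp
      rw [Finset.mem_range] at hj
      rw [length_initialSegment] at hle
      exact ⟨s, hs, by rw [show m = j from le_antisymm hle (Nat.lt_succ_iff.1 hj)]⟩
  refine ⟨List K →₀ F, inferInstance, inferInstance, inferInstance, a, b,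
    h m hm₀ (LinearMap.eqLocus (b ∘ₗ a) LinearMap.id) (fun s hs x => ?_)
      (fun t ht hlt => hnode t (Finset.mem_union_left _ (Finset.mem_filter.2 ⟨ht, hlt⟩)) hlt)
      (fun s hs j hj => hnode _ (Finset.mem_union_right _ (Finset.mem_image.2
        ⟨(s, j), Finset.mem_product.2 ⟨hs, Finset.mem_range.2 (by omega)⟩, rfl⟩)) (by simpa))⟩
  refine (hba _).trans ?_
  rw [Finset.sum_eq_single_of_mem (initialSegment s m) (Finset.mem_union_right _
    (Finset.mem_image.2 ⟨(s, m), Finset.mem_product.2 ⟨hs, Finset.mem_range.2 (by omega)⟩, rfl⟩))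
    fun t ht hne => ?_]
  · rw [hβ s hs, toPi_branch, if_pos (by simp)]
    simp [transition]
  · rw [toPi_branch, if_neg, map_zero]
    rintro ⟨h1, h2⟩
    obtain ⟨s', -, hs'⟩ := hlen t ht h2
    rw [← hs', length_initialSegment] at h1
    exact hne (hs'.symm.trans h1)

end TreeModule

end TreeModule

section Counting

/-- A vanishing extension group of a tree module with many branches, compared to the number of
linear maps out of the nodes, forces the solvability of the telescope equations. -/
theorem ExtVanish.exists_sub_comp_eq {K S F C : Type u} [Ring S] [AddCommGroup F] [Module S F]
    [AddCommGroup C] [Module S C] (J : (List K → F →ₗ[S] C) → ℕ → K) (hJ : Function.Injective J)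
    (u : ℕ → Module.End S F) (h : ExtVanish S (TreeModule K u) C) (c : ℕ → F →ₗ[S] C) :
    ∃ d : ℕ → F →ₗ[S] C, ∀ n, d n - d (n + 1) ∘ₗ u n = c n := by
  classical
  have key : ∀ A : Set (ℕ → K), ∃ (γ : (ℕ → K) → ℕ → F →ₗ[S] C) (ψ : List K → F →ₗ[S] C),
      ∀ s n x, γ s n x - γ s (n + 1) (u n x) - ψ (initialSegment s n) x =
        if s ∈ A then c n x else 0 := fun A => by
    let θ : ((ℕ → K) × ℕ →₀ F) →ₗ[S] C :=
      Finsupp.lsum ℕ fun p => if p.1 ∈ A then c p.2 else 0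
    let e := LinearEquiv.ofInjective (treeRelation K u) (treeRelation_injective u)
    let i : LinearMap.ker (LinearMap.range (treeRelation K u)).mkQ →ₗ[S]
        LinearMap.range (treeRelation K u) := Submodule.inclusion (Submodule.ker_mkQ _).le
    obtain ⟨g, hg⟩ := h _ (LinearMap.range (treeRelation K u)).mkQ (Submodule.mkQ_surjective _)
      (θ ∘ₗ e.symm.toLinearMap ∘ₗ i)
    have hg' : ∀ y, g (treeRelation K u y) = θ y := fun y => by
      have hy : treeRelation K u y ∈ LinearMap.ker (LinearMap.range (treeRelation K u)).mkQ := by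
        rw [Submodule.ker_mkQ]
        exact ⟨y, rfl⟩
      refine (hg ⟨_, hy⟩).trans (congrArg θ ?_)
      exact e.symm_apply_eq.2 rfl
    refine ⟨fun s n => g ∘ₗ LinearMap.inl S _ _ ∘ₗ Finsupp.lsingle (s, n),
      fun t => g ∘ₗ LinearMap.inr S _ _ ∘ₗ Finsupp.lsingle t, fun s n x => ?_⟩
    have hθ : θ (Finsupp.single (s, n) x) = if s ∈ A then c n x else 0 := by
      simp only [θ, Finsupp.lsum_single]
      split_ifs <;> rfl
    rw [← hθ, ← hg', treeRelation_single]
    simp only [LinearMap.comp_apply, Finsupp.lsingle_apply, ← map_sub]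
    simp
  choose γ ψ hγψ using key
  obtain ⟨A, A', hψ, hne⟩ : ∃ A A', ψ A = ψ A' ∧ A ≠ A' := by
    have := Function.cantor_injective fun A => J (ψ A)
    simp only [Function.Injective, not_forall] at this
    obtain ⟨A, A', h1, h2⟩ := this
    exact ⟨A, A', hJ h1, h2⟩
  have main : ∀ (B B' : Set (ℕ → K)) (s : ℕ → K), ψ B = ψ B' → s ∈ B → s ∉ B' →
      ∃ d : ℕ → F →ₗ[S] C, ∀ n, d n - d (n + 1) ∘ₗ u n = c n := fun B B' s hB hs hs' => by
    refine ⟨fun n => γ B s n - γ B' s n, fun n => LinearMap.ext fun x => ?_⟩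
    have h1 := hγψ B s n x
    have h2 := hγψ B' s n x
    rw [if_pos hs] at h1
    rw [if_neg hs', ← hB] at h2
    rw [← h1, ← sub_zero (_ - _ - ψ B _ x), ← h2]
    simp only [LinearMap.sub_apply, LinearMap.comp_apply]
    abel
  obtain ⟨s, hs⟩ : ∃ s, ¬(s ∈ A ↔ s ∈ A') := by
    by_contra! h
    exact hne (Set.ext h)
  by_cases hsA : s ∈ A
  · exact main A A' s hψ hsA fun h' => hs (iff_of_true hsA h')
  · exact main A' A s hψ.symm (by_contra fun h' => hs (iff_of_false hsA h')) hsA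

/-- The iterated power sets of a type. -/
def IteratedSet (T : Type u) : ℕ → Type u
  | 0 => T
  | n + 1 => Set (IteratedSet T n)

theorem exists_injective_nat_pi (F C : Type u) [Countable F] :
    ∃ (K : Type u) (J : (List K → F → C) → ℕ → K), Function.Injective J := by
  let K : Type u := Σ n, IteratedSet (C ⊕ ULift.{u} ℕ) n
  have hC : Cardinal.mk C ≤ Cardinal.mk K := Cardinal.mk_le_of_injective
    (f := fun c => (⟨0, Sum.inl c⟩ : K)) fun c c' h =>
      Sum.inl.inj (eq_of_heq (Sigma.mk.inj h).2)
  have hN : Function.Injective fun n : ℕ => (⟨0, Sum.inr ⟨n⟩⟩ : K) := fun n n' h =>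
    ULift.up.inj (Sum.inr.inj (eq_of_heq (Sigma.mk.inj h).2))
  have : Infinite K := Infinite.of_injective _ hN
  have hK := Cardinal.aleph0_le_mk K
  have hF : Cardinal.mk F ≤ Cardinal.mk K := Cardinal.mk_le_aleph0.trans hK
  have hle : Cardinal.mk (List K × F × C) ≤ Cardinal.mk K := by
    simp only [Cardinal.mk_prod, Cardinal.lift_id, Cardinal.mk_list_eq_mk]
    exact Cardinal.mul_le_of_le hK le_rfl (Cardinal.mul_le_of_le hK hF hC)
  obtain ⟨j⟩ := hle
  let P : Set K → ℕ → K := fun A n => ⟨n + 1, ({x | (⟨n, x⟩ : K) ∈ A} : Set (IteratedSet _ n))⟩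
  have hP : Function.Injective P := fun A A' h => by
    ext ⟨n, x⟩
    have h1 : ({x | (⟨n, x⟩ : K) ∈ A} : Set (IteratedSet _ n)) = {x | (⟨n, x⟩ : K) ∈ A'} :=
      eq_of_heq (Sigma.mk.inj (congrFun h n)).2
    exact Set.ext_iff.1 h1 x
  refine ⟨K, fun f => P (j '' {p | f p.1 p.2.1 = p.2.2}), fun f f' h => ?_⟩
  have h1 := j.injective.image_injective (hP h)
  funext t x
  exact (Set.ext_iff.1 h1 (t, x, f' t x)).2 rfl

end Counting

/-- The modules `C` with vanishing `Ext¹(X, C)` for all locally projective `X` also satisfy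
`Ext¹(M, C) = 0` for all `M` satisfying the equational criterion for flatness. -/
theorem KillsRelations.extVanish {S M C : Type u} [Ring S] [Countable S] [AddCommGroup M]
    [Module S M] [AddCommGroup C] [Module S C] (hM : KillsRelations S M)
    (H : ∀ (X : Type u) [AddCommGroup X] [Module S X], LocallyProjective S X → ExtVanish S X C) :
    ExtVanish S M C := by
  refine hM.extVanish_of_countable C fun N _ _ _ hN => ?_
  have hπ : Function.Surjective (Finsupp.linearCombination S (id : N → N)) := fun x =>
    ⟨Finsupp.single x 1, by simp⟩
  have : Countable (N →₀ S) := inferInstance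
  obtain ⟨u, hu, hk⟩ := hN.exists_telescope _ hπ
  obtain ⟨K, J, hJ⟩ := exists_injective_nat_pi (N →₀ S) C
  exact ExtVanish.of_telescope _ hπ u hu hk fun c => ExtVanish.exists_sub_comp_eq
    (fun f => J fun t => f t) (hJ.comp fun f f' h => funext fun t =>
      DFunLike.coe_injective (congrFun h t)) u (H _ (TreeModule.locallyProjective u)) c

/-- If `R` is a countable ring and `𝒟` is the class of flat
Mittag-Leffler right `R`-modules, then the double orthogonal class `^⊥(𝒟^⊥)` consists
exactly of the flat right `R`-modules. -/
theorem double_perp_flat_mittagLeffler_eq_flat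
    (R : Type u) [Ring R] [Countable R] (M : ModuleCat.{u} Rᵐᵒᵖ) :
    (∀ C : ModuleCat.{u} Rᵐᵒᵖ,
        (∀ D : ModuleCat.{u} Rᵐᵒᵖ, IsRightFlat R D → IsMittagLeffler R D →
          Subsingleton (ext1 R D C)) →
        Subsingleton (ext1 R M C)) ↔
      IsRightFlat R M := by
  constructor
  · intro h
    refine isRightFlat_of_extVanish fun Q _ _ => ?_
    refine (subsingleton_ext1_iff R M (ModuleCat.of Rᵐᵒᵖ (RightDual R Q))).1 (h _ fun D hD _ => ?_)
    exact (subsingleton_ext1_iff R D _).2 (hD.extVanish_rightDual Q)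
  · intro hM C hC
    have : Countable Rᵐᵒᵖ := MulOpposite.opEquiv.countable_iff.1 ‹_›
    refine (subsingleton_ext1_iff R M C).2 (hM.killsRelations.extVanish fun X _ _ hX => ?_)
    exact (subsingleton_ext1_iff R (ModuleCat.of Rᵐᵒᵖ X) C).1
      (hC _ hX.isRightFlat hX.isMittagLeffler)
end

section
/- Let R be a ring, let F_0 → F_1 → F_2 → ⋯ be a chain of R-module homomorphisms u_n : F_n → F_{n+1}, and let φ : ⊕_{n<ω} F_n → ⊕_{n<ω} F_n be the homomorphism determined by φ∘ι_n = ι_n − ι_{n+1}∘u_n, where ι_n : F_n → ⊕_{m<ω} F_m are the canonical inclusions. Then for every n_0 < ω, the module ⊕_{n<ω} F_n decomposes as the internal direct sum φ(⊕_{m<n_0} F_m) ⊕ (⊕_{m≥n_0} F_m); in particular every element y ∈ ⊕_{n<ω} F_n has a unique expression y = z + w with z ∈ φ(⊕_{m<n_0} F_m) and w ∈ ⊕_{m≥n_0} F_m. -/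
universe u

open DirectSum

/-- Elements of the sum of the summands indexed by `p` vanish at all coordinates outside `p`. -/
theorem DirectSum.apply_eq_zero_of_mem_iSup_range_lof {S ι : Type*} [DecidableEq ι] [Semiring S]
    {M : ι → Type*} [∀ i, AddCommMonoid (M i)] [∀ i, Module S (M i)] {p : ι → Prop}
    {x : ⨁ i, M i} (hx : x ∈ ⨆ i, ⨆ _ : p i, LinearMap.range (DirectSum.lof S ι M i))
    {k : ι} (hk : ¬ p k) : x k = 0 := by
  have hle : (⨆ i, ⨆ _ : p i, LinearMap.range (DirectSum.lof S ι M i)) ≤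
      LinearMap.ker (DirectSum.component S ι M k) := by
    refine iSup₂_le fun i hi ↦ ?_
    rintro _ ⟨a, rfl⟩
    have hik : i ≠ k := fun h ↦ hk (h ▸ hi)
    simp [DirectSum.component.of, hik]
  exact hle hx

section Chain

variable {S : Type*} [Ring S] {F : ℕ → Type*} [∀ n, AddCommGroup (F n)] [∀ n, Module S (F n)]
  {t : ∀ n, F n →ₗ[S] F (n + 1)} {φ : (⨁ n, F n) →ₗ[S] ⨁ n, F n}

theorem DirectSum.chain_apply_zero
    (hφ : ∀ (n : ℕ) (x : F n), φ (DirectSum.lof S ℕ F n x) =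
      DirectSum.lof S ℕ F n x - DirectSum.lof S ℕ F (n + 1) (t n x))
    (a : ⨁ n, F n) : φ a 0 = a 0 := by
  have h : DirectSum.component S ℕ F 0 ∘ₗ φ = DirectSum.component S ℕ F 0 := by
    refine DirectSum.linearMap_ext S fun n ↦ LinearMap.ext fun x ↦ ?_
    simp [hφ, DirectSum.component.of]
  exact LinearMap.congr_fun h a

theorem DirectSum.chain_apply_succ
    (hφ : ∀ (n : ℕ) (x : F n), φ (DirectSum.lof S ℕ F n x) =
      DirectSum.lof S ℕ F n x - DirectSum.lof S ℕ F (n + 1) (t n x))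
    (a : ⨁ n, F n) (k : ℕ) : φ a (k + 1) = a (k + 1) - t k (a k) := by
  have h : DirectSum.component S ℕ F (k + 1) ∘ₗ φ =
      DirectSum.component S ℕ F (k + 1) - t k ∘ₗ DirectSum.component S ℕ F k := by
    refine DirectSum.linearMap_ext S fun n ↦ LinearMap.ext fun x ↦ ?_
    rcases eq_or_ne n k with rfl | hn
    · simp [hφ, DirectSum.component.of]
    · simp [hφ, DirectSum.component.of, hn]
  exact LinearMap.congr_fun h a

theorem DirectSum.disjoint_map_chain
    (hφ : ∀ (n : ℕ) (x : F n), φ (DirectSum.lof S ℕ F n x) =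
      DirectSum.lof S ℕ F n x - DirectSum.lof S ℕ F (n + 1) (t n x)) (n₀ : ℕ) :
    Disjoint
      (Submodule.map φ (⨆ m, ⨆ _ : m < n₀, LinearMap.range (DirectSum.lof S ℕ F m)))
      (⨆ m, ⨆ _ : n₀ ≤ m, LinearMap.range (DirectSum.lof S ℕ F m)) := by
  rw [Submodule.disjoint_def]
  rintro _ ⟨a, ha, rfl⟩ hb
  have hlow : ∀ k, k < n₀ → a k = 0 := by
    intro k
    induction k with
    | zero =>
      intro hk
      rw [← DirectSum.chain_apply_zero hφ]
      exact DirectSum.apply_eq_zero_of_mem_iSup_range_lof hb (by omega)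
    | succ k ih =>
      intro hk
      have h := DirectSum.chain_apply_succ hφ a k
      rw [ih (by omega), map_zero, sub_zero] at h
      rw [← h]
      exact DirectSum.apply_eq_zero_of_mem_iSup_range_lof hb (by omega)
  have ha₀ : a = 0 := by
    refine DFinsupp.ext fun k ↦ ?_
    by_cases hk : k < n₀
    · exact hlow k hk
    · exact DirectSum.apply_eq_zero_of_mem_iSup_range_lof ha hk
  rw [ha₀, map_zero]

theorem DirectSum.codisjoint_map_chain
    (hφ : ∀ (n : ℕ) (x : F n), φ (DirectSum.lof S ℕ F n x) =
      DirectSum.lof S ℕ F n x - DirectSum.lof S ℕ F (n + 1) (t n x)) (n₀ : ℕ) :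
    Codisjoint
      (Submodule.map φ (⨆ m, ⨆ _ : m < n₀, LinearMap.range (DirectSum.lof S ℕ F m)))
      (⨆ m, ⨆ _ : n₀ ≤ m, LinearMap.range (DirectSum.lof S ℕ F m)) := by
  set A := ⨆ m, ⨆ _ : m < n₀, LinearMap.range (DirectSum.lof S ℕ F m)
  set B := ⨆ m, ⨆ _ : n₀ ≤ m, LinearMap.range (DirectSum.lof S ℕ F m)
  have hge : ∀ k, n₀ ≤ k → ∀ x : F k, DirectSum.lof S ℕ F k x ∈ Submodule.map φ A ⊔ B :=
    fun k hk x ↦ Submodule.mem_sup_right <|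
      (le_iSup₂_of_le k hk le_rfl : LinearMap.range (DirectSum.lof S ℕ F k) ≤ B) ⟨x, rfl⟩
  have hlof : ∀ d k, n₀ ≤ k + d → ∀ x : F k,
      DirectSum.lof S ℕ F k x ∈ Submodule.map φ A ⊔ B := by
    intro d
    induction d with
    | zero => exact hge
    | succ d ih =>
      intro k hk x
      by_cases hkn : n₀ ≤ k
      · exact hge k hkn x
      · have hx : DirectSum.lof S ℕ F k x ∈ A :=
          (le_iSup₂_of_le k (not_le.mp hkn) le_rfl :
            LinearMap.range (DirectSum.lof S ℕ F k) ≤ A) ⟨x, rfl⟩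
        rw [← sub_add_cancel (DirectSum.lof S ℕ F k x)
          (DirectSum.lof S ℕ F (k + 1) (t k x)), ← hφ]
        exact add_mem (Submodule.mem_sup_left (Submodule.mem_map_of_mem hx))
          (ih (k + 1) (by omega) _)
  rw [codisjoint_iff, eq_top_iff]
  rintro y -
  induction y using DirectSum.induction_on with
  | zero => exact zero_mem _
  | of k x => exact hlof n₀ k (by omega) x
  | add y z hy hz => exact add_mem hy hz

end Chain

/-- Given a chain `F 0 → F 1 → F 2 → ⋯` of right `R`-module maps and the
map `φ : ⨁ₙ F n → ⨁ₙ F n` determined by `φ ∘ ιₙ = ιₙ - ι_{n+1} ∘ uₙ`, for every `n₀` the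
direct sum `⨁ₙ F n` decomposes as the internal direct sum
`φ(⨁_{m < n₀} F m) ⊕ (⨁_{m ≥ n₀} F m)`; in particular every element `y` can be written
uniquely as `y = z + w` with `z ∈ φ(⨁_{m < n₀} F m)` and `w ∈ ⨁_{m ≥ n₀} F m`. -/
theorem directSum_decomposition_of_chain
    (R : Type u) [Ring R] (F : ℕ → Type u) [∀ n, AddCommGroup (F n)]
    [∀ n, Module Rᵐᵒᵖ (F n)] (t : ∀ n, F n →ₗ[Rᵐᵒᵖ] F (n + 1))
    (φ : (⨁ n, F n) →ₗ[Rᵐᵒᵖ] ⨁ n, F n)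
    (hφ : ∀ (n : ℕ) (x : F n), φ (DirectSum.lof Rᵐᵒᵖ ℕ F n x) =
      DirectSum.lof Rᵐᵒᵖ ℕ F n x - DirectSum.lof Rᵐᵒᵖ ℕ F (n + 1) (t n x))
    (n₀ : ℕ) :
    IsCompl
        (Submodule.map φ
          (⨆ m, ⨆ _ : m < n₀, LinearMap.range (DirectSum.lof Rᵐᵒᵖ ℕ F m)))
        (⨆ m, ⨆ _ : n₀ ≤ m, LinearMap.range (DirectSum.lof Rᵐᵒᵖ ℕ F m)) ∧
      ∀ y : ⨁ n, F n,
        ∃! zw : (↥(Submodule.map φ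
              (⨆ m, ⨆ _ : m < n₀, LinearMap.range (DirectSum.lof Rᵐᵒᵖ ℕ F m)))) ×
            (↥(⨆ m, ⨆ _ : n₀ ≤ m, LinearMap.range (DirectSum.lof Rᵐᵒᵖ ℕ F m))),
          y = (zw.1 : ⨁ n, F n) + (zw.2 : ⨁ n, F n) := by
  have hc := IsCompl.mk (DirectSum.disjoint_map_chain hφ n₀) (DirectSum.codisjoint_map_chain hφ n₀)
  refine ⟨hc, fun y ↦ ?_⟩
  simpa only [eq_comm] using Submodule.existsUnique_add_of_isCompl_prod hc y
end

section
/- Let λ be an infinite cardinal. Then there is a set J ⊆ λ^ω of functions from ω to λ, of cardinality λ^{ℵ₀}, such that for any two distinct f, g ∈ J the set {n < ω : f(n) = g(n)} is a finite initial segment of ω (i.e., there exists k < ω with {n < ω : f(n) = g(n)} = {0, 1, …, k−1}). -/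
universe u

/-- The codes of the restrictions of two distinct sequences to `{0, …, n - 1}`
agree exactly for `n` up to the first place where the sequences differ. -/
theorem exists_setOf_ofFn_eq_Iio {α β : Type*} {e : List α → β} (he : Function.Injective e)
    {f g : ℕ → α} (hfg : f ≠ g) :
    ∃ k : ℕ, {n : ℕ | e (List.ofFn fun i : Fin n => f i) = e (List.ofFn fun i : Fin n => g i)} =
      Set.Iio k := by
  classical
  have h : ∃ n, f n ≠ g n := Function.ne_iff.mp hfg
  refine ⟨Nat.find h + 1, ?_⟩
  ext n
  rw [Set.mem_ofPred_eq, he.eq_iff, List.ofFn_inj, Set.mem_Iio, Nat.lt_succ_iff, Nat.le_find_iff,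
    funext_iff, Fin.forall_iff]
  simp only [not_not]

/-- For every infinite cardinal `λ` there is a family
`J ⊆ λ^ω` of cardinality `λ ^ ℵ₀` of functions `ω → λ` such that any two distinct
members of `J` agree exactly on a finite initial segment of `ω`. -/
theorem exists_almost_disjoint_family (l : Cardinal.{u}) (hl : Cardinal.aleph0.{u} ≤ l) :
    ∃ J : Set (ℕ → Quotient.out l),
      Cardinal.mk J = l ^ Cardinal.aleph0.{u} ∧
        ∀ f ∈ J, ∀ g ∈ J, f ≠ g →
          ∃ k : ℕ, {n : ℕ | f n = g n} = Set.Iio k := by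
  have : Infinite (Quotient.out l) := by
    rwa [Cardinal.infinite_iff, Cardinal.mk_out]
  obtain ⟨e⟩ := Cardinal.eq.mp (Cardinal.mk_list_eq_mk (Quotient.out l))
  let F : (ℕ → Quotient.out l) → ℕ → Quotient.out l :=
    fun f n => e (List.ofFn fun i : Fin n => f i)
  have hF : Function.Injective F := by
    intro f g hfg
    ext n
    have h := List.ofFn_injective (e.injective (congrFun hfg (n + 1)))
    exact congrFun h (Fin.last n)
  refine ⟨Set.range F, ?_, ?_⟩
  · rw [Cardinal.mk_range_eq F hF]
    simp
  · rintro _ ⟨f, rfl⟩ _ ⟨g, rfl⟩ hne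
    exact exists_setOf_ofFn_eq_Iio e.injective fun h => hne (congrArg F h)
end
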